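/- (Polynomial core of the main theorem.) Let F ∈ ℂ[X,Y,Z] be an irreducible homogeneous polynomial of degree d ≥ 4 whose curve F = 0 has only nodes as singularities, let Δ be the set of nodes, n = |Δ| ≤ binom(d−1,2) − 1. Then there exists a homogeneous polynomial σ̃ of degree d vanishing at every point of Δ with the following property: if a, b, c ∈ ℂ[X,Y,Z] are homogeneous of degree d − 2 and h ∈ ℂ[X,Y,Z] is homogeneous of degree d − 3 and vanishes at every point of Δ, and if a·F_X + b·F_Y + c·F_Z = σ̃·h, then h = 0 (and hence a·F_X + b·F_Y + c·F_Z = 0). Equivalently, the subspace {a·F_X + b·F_Y + c·F_Z : a, b, c homogeneous of degree d−2} of forms of degree 2d − 3 meets the subspace σ̃·V_{d−3}(Δ) only in 0. -/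

import Mathlib

open MvPolynomial

noncomputable section

/-- The complex projective plane. -/
abbrev P2 : Type := Projectivization ℂ (Fin 3 → ℂ)

/-- A (homogeneous) polynomial `G` vanishes at a point `p ∈ ℙ²`. -/
def VanAt (G : MvPolynomial (Fin 3) ℂ) (p : P2) : Prop :=
  eval p.rep G = 0

/-- The submodule of polynomials vanishing at every point of `S`. -/
def vanishing (S : Set P2) : Submodule ℂ (MvPolynomial (Fin 3) ℂ) where
  carrier := {G | ∀ p ∈ S, VanAt G p}
  add_mem' := by
    intro a b ha hb p hp
    have h1 := ha p hp
    have h2 := hb p hp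
    simp only [VanAt] at h1 h2 ⊢
    simp [h1, h2]
  zero_mem' := by
    intro p hp
    simp [VanAt]
  smul_mem' := by
    intro c G hG p hp
    have h1 := hG p hp
    simp only [VanAt] at h1 ⊢
    simp [h1]

/-- `V_k(S)`: homogeneous polynomials of degree `k` (together with `0`)
vanishing at every point of `S`. -/
def Vsp (k : ℕ) (S : Set P2) : Submodule ℂ (MvPolynomial (Fin 3) ℂ) :=
  homogeneousSubmodule (Fin 3) ℂ k ⊓ vanishing S

/-- `p` is a singular point of the curve `F = 0`. -/
def SingPt (F : MvPolynomial (Fin 3) ℂ) (p : P2) : Prop :=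
  ∀ i : Fin 3, eval p.rep (pderiv i F) = 0

/-- `p` is a node of the curve `F = 0`. -/
def IsNode (F : MvPolynomial (Fin 3) ℂ) (p : P2) : Prop :=
  SingPt F p ∧
    (Matrix.of fun i j : Fin 3 => eval p.rep (pderiv i (pderiv j F))).rank = 2

/-- The curve `F = 0` is nodal: every singular point is a node. -/
def Nodal (F : MvPolynomial (Fin 3) ℂ) : Prop :=
  ∀ p : P2, SingPt F p → IsNode F p

/-- The set of nodes of the curve `F = 0`. -/
def nodes (F : MvPolynomial (Fin 3) ℂ) : Set P2 :=
  {p | IsNode F p}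

/-- The common zero set in `ℙ²` of two polynomials. -/
def zeroSet (F₁ F₂ : MvPolynomial (Fin 3) ℂ) : Set P2 :=
  {p | VanAt F₁ p ∧ VanAt F₂ p}


set_option linter.unusedVariables false
set_option linter.unusedSectionVars false


abbrev S3 : Type := MvPolynomial (Fin 3) ℂ
abbrev V3 : Type := Fin 3 → ℂ

lemma hom_eval_smul {σ : Type} [Finite σ] {f : MvPolynomial σ ℂ} {n : ℕ} (hf : f.IsHomogeneous n)
    (c : ℂ) (p : σ → ℂ) :
    eval (c • p) f = c ^ n * eval p f := by
  rw [eval_eq, eval_eq, Finset.mul_sum]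
  refine Finset.sum_congr rfl fun m hm => ?_
  have h := hf.degree_eq_sum_deg_support hm
  simp only [Pi.smul_apply, smul_eq_mul, mul_pow, Finset.prod_mul_distrib]
  rw [Finset.prod_pow_eq_pow_sum]
  rw [h]; ring

lemma hcomp_mul {σ : Type} {f : MvPolynomial σ ℂ} {m : ℕ} (hf : f.IsHomogeneous m)
    (a : MvPolynomial σ ℂ) (n : ℕ) :
    homogeneousComponent (n + m) (a * f) = homogeneousComponent n a * f := by
  conv_lhs => rw [← sum_homogeneousComponent a, Finset.sum_mul, map_sum]
  have : ∀ i ∈ Finset.range (a.totalDegree + 1),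
      homogeneousComponent (n + m) (homogeneousComponent i a * f) =
        if i = n then homogeneousComponent n a * f else 0 := by
    intro i _
    rw [homogeneousComponent_of_mem (n := i + m)
      ((homogeneousComponent_isHomogeneous i a).mul hf)]
    by_cases h : i = n
    · subst h; simp
    · rw [if_neg (by omega), if_neg h]
  rw [Finset.sum_congr rfl this, Finset.sum_ite_eq']
  split_ifs with h
  · rfl
  · rw [homogeneousComponent_eq_zero _ _ (by simpa using h), zero_mul]

lemma hcomp_mul_lt {σ : Type} {f : MvPolynomial σ ℂ} {m : ℕ} (hf : f.IsHomogeneous m)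
    (a : MvPolynomial σ ℂ) (k : ℕ) (hk : k < m) :
    homogeneousComponent k (a * f) = 0 := by
  conv_lhs => rw [← sum_homogeneousComponent a, Finset.sum_mul, map_sum]
  refine Finset.sum_eq_zero fun i _ => ?_
  rw [homogeneousComponent_of_mem (n := i + m) ((homogeneousComponent_isHomogeneous i a).mul hf),
    if_neg (by omega)]

/-- homogeneous coefficient representation, two generators -/
lemma hom_rep2 {σ : Type} {f g u α β : MvPolynomial σ ℂ} {m n k : ℕ} (hf : f.IsHomogeneous m)
    (hg : g.IsHomogeneous n) (hu : u.IsHomogeneous k) (h : u = α * f + β * g) :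
    ∃ α' β', u = α' * f + β' * g ∧ α'.IsHomogeneous (k - m) ∧ β'.IsHomogeneous (k - n) ∧
      (k < m → α' = 0) ∧ (k < n → β' = 0) := by
  have key : ∀ {f : MvPolynomial σ ℂ} {m : ℕ} (α), f.IsHomogeneous m →
      ∃ α', homogeneousComponent k (α * f) = α' * f ∧ α'.IsHomogeneous (k - m) ∧
        (k < m → α' = 0) := by
    intro f m α hf
    by_cases hk : k < m
    · exact ⟨0, by rw [hcomp_mul_lt hf _ _ hk, zero_mul], isHomogeneous_zero _ _ _, fun _ => rfl⟩
    · refine ⟨homogeneousComponent (k - m) α, ?_, homogeneousComponent_isHomogeneous _ _,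
        fun h => absurd h hk⟩
      rw [← hcomp_mul hf]; congr 1; 
      rw [Nat.sub_add_cancel (by omega)]
  obtain ⟨α', h1, h2, h3⟩ := key α hf
  obtain ⟨β', h4, h5, h6⟩ := key β hg
  refine ⟨α', β', ?_, h2, h5, h3, h6⟩
  rw [← h1, ← h4, ← map_add, ← h, homogeneousComponent_of_mem (n := k) hu, if_pos rfl]

lemma hom_dvd {σ : Type} {f u : MvPolynomial σ ℂ} {m k : ℕ} (hf : f.IsHomogeneous m)
    (hu : u.IsHomogeneous k) (h : f ∣ u) :
    ∃ α, u = α * f ∧ α.IsHomogeneous (k - m) ∧ (k < m → α = 0) := by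
  obtain ⟨a, ha⟩ := h
  obtain ⟨α, β, h1, h2, _, h3, _⟩ := hom_rep2 (α := a) (β := 0) hf (isHomogeneous_zero _ _ 0) hu
    (by rw [ha]; ring)
  exact ⟨α, by simpa using h1, h2, h3⟩

lemma hom_dvd_lt {σ : Type} {f u : MvPolynomial σ ℂ} {m k : ℕ} (hf : f.IsHomogeneous m)
    (hu : u.IsHomogeneous k) (h : f ∣ u) (hk : k < m) : u = 0 := by
  obtain ⟨a, ha, _, h3⟩ := hom_dvd hf hu h
  rw [ha, h3 hk, zero_mul]

lemma hom_zero_of_ideal {σ : Type} {f g u α β : MvPolynomial σ ℂ} {m n k : ℕ} (hf : f.IsHomogeneous m)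
    (hg : g.IsHomogeneous n) (hu : u.IsHomogeneous k) (h : u = α * f + β * g)
    (h1 : k < m) (h2 : k < n) : u = 0 := by
  obtain ⟨a, b, h, _, _, h3, h4⟩ := hom_rep2 hf hg hu h
  rw [h, h3 h1, h4 h2]; simp

/-- The prime ideal of the line through `p`. -/
def lineHom (p : V3) : S3 →ₐ[ℂ] Polynomial ℂ :=
  aeval fun i => Polynomial.C (p i) * Polynomial.X

def lineI (p : V3) : Ideal S3 := RingHom.ker (lineHom p)

instance (p : V3) : (lineI p).IsPrime := RingHom.ker_isPrime _

lemma eval_lineHom (p : V3) (c : ℂ) (f : S3) :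
    Polynomial.eval c (lineHom p f) = eval (c • p) f := by
  unfold lineHom
  induction f using MvPolynomial.induction_on with
  | C a => simp
  | add p q hp hq => simp [hp, hq]
  | mul_X p n hp => simp [hp]; left; ring

lemma mem_lineI {p : V3} {f : S3} : f ∈ lineI p ↔ ∀ c : ℂ, eval (c • p) f = 0 := by
  unfold lineI
  rw [RingHom.mem_ker]
  constructor
  · intro h c
    rw [← eval_lineHom]
    erw [h]; simp
  · intro h
    apply Polynomial.funext
    intro r
    erw [eval_lineHom]
    simp [h]

lemma mem_lineI_hom {p : V3} {f : S3} {n : ℕ} (hf : f.IsHomogeneous n) :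
    f ∈ lineI p ↔ eval p f = 0 := by
  rw [mem_lineI]
  constructor
  · intro h; simpa using h 1
  · intro h c; rw [hom_eval_smul hf, h, mul_zero]

lemma cross_hom (p : V3) (i j : Fin 3) :
    (C (p i) * X j - C (p j) * X i : S3).IsHomogeneous 1 :=
  (isHomogeneous_C_mul_X _ _).sub (isHomogeneous_C_mul_X _ _)

lemma parallel_of_cross {p q : V3} (hp : p ≠ 0) (h : ∀ i j, p i * q j - p j * q i = 0) :
    ∃ c : ℂ, q = c • p := by
  obtain ⟨i, hi⟩ := Function.ne_iff.1 hp
  refine ⟨q i / p i, funext fun j => ?_⟩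
  have := h i j
  simp only [Pi.zero_apply] at hi
  simp only [Pi.smul_apply, smul_eq_mul]
  field_simp
  linear_combination this

lemma lineI_minimal {F g : S3} {d k : ℕ} (hirr : Irreducible F)
    (hF : F.IsHomogeneous d) (hg : g.IsHomogeneous k) (hFg : ¬ F ∣ g)
    {p : V3} (hp : p ≠ 0) (h1 : eval p F = 0) (h2 : eval p g = 0)
    (Q : Ideal S3) [hQ : Q.IsPrime] (hFQ : F ∈ Q) (hgQ : g ∈ Q) (hle : Q ≤ lineI p) :
    Q = lineI p := by
  by_contra hne
  have hlt : Q < lineI p := lt_of_le_of_ne hle hne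
  have hFp : (Ideal.span {F}).IsPrime :=
    (Ideal.span_singleton_prime hirr.ne_zero).2 hirr.prime
  let x0 : PrimeSpectrum S3 := ⟨⊥, Ideal.isPrime_bot⟩
  let x1 : PrimeSpectrum S3 := ⟨Ideal.span {F}, hFp⟩
  let x2 : PrimeSpectrum S3 := ⟨Q, hQ⟩
  let x3 : PrimeSpectrum S3 := ⟨lineI p, inferInstance⟩
  let x4 : PrimeSpectrum S3 := ⟨lineI 0, inferInstance⟩
  have h01 : x0 < x1 := by
    rw [← PrimeSpectrum.asIdeal_lt_asIdeal]
    change (⊥ : Ideal S3) < Ideal.span {F}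
    rw [bot_lt_iff_ne_bot]
    simpa using hirr.ne_zero
  have h12 : x1 < x2 := by
    rw [← PrimeSpectrum.asIdeal_lt_asIdeal]
    refine lt_of_le_of_ne ((Ideal.span_singleton_le_iff_mem _).2 hFQ) ?_
    intro h
    have h' : Ideal.span {F} = Q := h
    rw [← h', Ideal.mem_span_singleton] at hgQ
    exact hFg hgQ
  have h23 : x2 < x3 := by
    rw [← PrimeSpectrum.asIdeal_lt_asIdeal]; exact hlt
  have h34 : x3 < x4 := by
    rw [← PrimeSpectrum.asIdeal_lt_asIdeal]
    change lineI p < lineI 0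
    refine lt_of_le_of_ne ?_ ?_
    · intro f hf
      rw [mem_lineI] at hf ⊢
      intro c
      simpa using hf 0
    · intro h
      apply hp
      funext i
      have : (X i : S3) ∈ lineI 0 := by rw [mem_lineI_hom (isHomogeneous_X _ _)]; simp
      rw [← h, mem_lineI_hom (isHomogeneous_X _ _)] at this
      simpa using this
  have e1 := Order.height_add_one_le h01
  have e2 := Order.height_add_one_le h12
  have e3 := Order.height_add_one_le h23
  have e4 := Order.height_add_one_le h34
  have e5 : (4 : ℕ∞) ≤ Order.height x4 := by
    calc (4 : ℕ∞) = 0 + 1 + 1 + 1 + 1 := by norm_num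
      _ ≤ Order.height x0 + 1 + 1 + 1 + 1 := by gcongr; simp
      _ ≤ Order.height x1 + 1 + 1 + 1 := by gcongr
      _ ≤ Order.height x2 + 1 + 1 := by gcongr
      _ ≤ Order.height x3 + 1 := by gcongr
      _ ≤ _ := e4
  have e6 := Order.height_le_krullDim x4
  have e7 : ringKrullDim S3 = 3 := by
    rw [MvPolynomial.ringKrullDim_of_isNoetherianRing]; simp
  have e8 : Order.krullDim (PrimeSpectrum S3) = 3 := e7
  rw [e8] at e6
  have : ((4 : ℕ∞) : WithBot ℕ∞) ≤ ((3 : ℕ∞) : WithBot ℕ∞) :=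
    le_trans (by exact_mod_cast e5) e6
  have h43 : (4 : ℕ∞) ≤ 3 := by exact_mod_cast this
  revert h43; decide

lemma finite_common_zeros {F g : S3} {d k : ℕ} (hirr : Irreducible F)
    (hF : F.IsHomogeneous d) (hg : g.IsHomogeneous k) (hFg : ¬ F ∣ g) :
    ∃ B : Finset V3, (∀ b ∈ B, b ≠ 0 ∧ eval b F = 0 ∧ eval b g = 0) ∧
      ∀ p : V3, p ≠ 0 → eval p F = 0 → eval p g = 0 → ∃ b ∈ B, ∃ c : ℂ, c ≠ 0 ∧ p = c • b := by
  classical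
  let Z : Set V3 := {p | p ≠ 0 ∧ eval p F = 0 ∧ eval p g = 0}
  have hfin : (lineI '' Z).Finite := by
    apply (Ideal.finite_minimalPrimes_of_isNoetherianRing S3 (Ideal.span {F, g})).subset
    rintro _ ⟨p, ⟨hp, h1, h2⟩, rfl⟩
    have hle : Ideal.span {F, g} ≤ lineI p := by
      rw [Ideal.span_le]
      rintro x (rfl | rfl)
      · exact (mem_lineI_hom hF).2 h1
      · exact (mem_lineI_hom hg).2 h2
    obtain ⟨Q, hQ, hQle⟩ := Ideal.exists_minimalPrimes_le hle
    have := hQ.1.1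
    have hQF : F ∈ Q := hQ.1.2 (Ideal.subset_span (by simp))
    have hQg : g ∈ Q := hQ.1.2 (Ideal.subset_span (by simp))
    rw [← lineI_minimal hirr hF hg hFg hp h1 h2 Q hQF hQg hQle]
    exact hQ
  obtain ⟨B, hBZ, hB⟩ := Set.exists_subset_bijOn Z lineI
  have hBfin : B.Finite := by
    apply Set.Finite.of_finite_image (f := lineI) _ hB.injOn
    rw [hB.image_eq]; exact hfin
  refine ⟨hBfin.toFinset, fun b hb => hBZ (by simpa using hb), fun p hp h1 h2 => ?_⟩
  obtain ⟨b, hb, hbp⟩ := hB.surjOn ⟨p, ⟨hp, h1, h2⟩, rfl⟩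
  refine ⟨b, by simpa using hb, ?_⟩
  obtain ⟨c, hc⟩ := parallel_of_cross (p := b) (q := p) (hBZ hb).1 (by
    intro i j
    have : (C (b i) * X j - C (b j) * X i : S3) ∈ lineI b := by
      rw [mem_lineI_hom (cross_hom _ _ _)]; simp; ring
    rw [hbp, mem_lineI_hom (cross_hom _ _ _)] at this
    simpa using this)
  refine ⟨c, ?_, hc⟩
  rintro rfl
  simp at hc; exact hp hc



/-- The curve data, in terms of vectors. -/
structure Ctx (e : ℕ) (F : S3) : Prop where
  hF : F.IsHomogeneous (e + 4)
  hirr : Irreducible F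
  nod : ∀ p : V3, p ≠ 0 → (∀ i, eval p (pderiv i F) = 0) → ∀ v : V3,
    (∀ i, ∑ j, v j * eval p (pderiv j (pderiv i F)) = 0) → ∃ c : ℂ, v = c • p
  fin : ∃ B : Finset V3, (∀ b ∈ B, b ≠ 0 ∧ ∀ i, eval b (pderiv i F) = 0) ∧
    ∀ p : V3, p ≠ 0 → (∀ i, eval p (pderiv i F) = 0) → ∃ b ∈ B, ∃ c : ℂ, c ≠ 0 ∧ p = c • b

lemma hom_cast {σ : Type} {f : MvPolynomial σ ℂ} {m n : ℕ} (h : f.IsHomogeneous m) (e : m = n) :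
    f.IsHomogeneous n := e ▸ h

/-- Directional derivative. -/
def dd (o : V3) : Derivation ℂ S3 S3 := 
  (C (o 0) : S3) • pderiv 0 + (C (o 1) : S3) • pderiv 1 + (C (o 2) : S3) • pderiv 2

lemma dd_apply (o : V3) (f : S3) : dd o f = ∑ i, C (o i) * pderiv i f := by
  simp [dd, Fin.sum_univ_three]

lemma pd_comm (i j : Fin 3) (f : S3) : pderiv i (pderiv j f) = pderiv j (pderiv i f) := by
  have : ⁅pderiv (R := ℂ) i, pderiv (R := ℂ) j⁆ = 0 := by
    apply MvPolynomial.derivation_ext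
    intro k
    rw [Derivation.commutator_apply]
    by_cases h1 : j = k <;> by_cases h2 : i = k <;>
      simp [pderiv_X, h1, h2, eq_comm]
  have h := congrArg (fun D => D f) this
  rw [Derivation.commutator_apply] at h
  simpa [sub_eq_zero] using h

lemma dd_pd (o : V3) (i : Fin 3) (f : S3) : dd o (pderiv i f) = pderiv i (dd o f) := by
  simp only [dd_apply, map_sum, Derivation.leibniz, pderiv_C, smul_eq_mul]
  refine Finset.sum_congr rfl fun j _ => ?_
  rw [pd_comm j i]; simp

lemma dd_hom {o : V3} {f : S3} {n : ℕ} (hf : f.IsHomogeneous n) :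
    (dd o f).IsHomogeneous (n - 1) := by
  rw [dd_apply]
  exact IsHomogeneous.sum _ _ _ fun i _ => (hf.pderiv).C_mul _

lemma euler_eval {f : S3} {n : ℕ} (hf : f.IsHomogeneous n) (p : V3) :
    ∑ i, p i * eval p (pderiv i f) = n * eval p f := by
  have := congrArg (eval p) hf.sum_X_mul_pderiv
  simpa using this

lemma eval_dd (o p : V3) (f : S3) : eval p (dd o f) = ∑ i, o i * eval p (pderiv i f) := by
  simp [dd_apply]

lemma eval_zero_of_dd {w : V3} {f : S3} {n : ℕ} (hf : f.IsHomogeneous (n + 1)) (h : dd w f = 0) :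
    eval w f = 0 := by
  have h1 := euler_eval hf w
  rw [← eval_dd, h, map_zero] at h1
  have : ((n + 1 : ℕ) : ℂ) ≠ 0 := by exact_mod_cast Nat.succ_ne_zero n
  exact (mul_eq_zero.1 h1.symm).resolve_left this

lemma exists_zero_ne {σ : Type} [Finite σ] {f g : MvPolynomial σ ℂ} (hf : Prime f) (h : ¬ f ∣ g) :
    ∃ p, eval p f = 0 ∧ eval p g ≠ 0 := by
  by_contra hcon
  push Not at hcon
  have hp : (Ideal.span {f}).IsPrime := (Ideal.span_singleton_prime hf.ne_zero).2 hf
  have := vanishingIdeal_zeroLocus_eq_radical (K := ℂ) (Ideal.span {f})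
  rw [hp.radical] at this
  apply h
  rw [← Ideal.mem_span_singleton, ← this, mem_vanishingIdeal_iff]
  intro x hx
  have h0 := (mem_zeroLocus_iff.1 hx) f (Ideal.subset_span rfl)
  have := hcon x (by simpa [aeval_eq_eval] using h0)
  simpa [aeval_eq_eval] using this

lemma Ctx.no_dir {e : ℕ} {F : S3} (h : Ctx e F) {w : V3} (hw : w ≠ 0) (i : Fin 3) (hi : w i = 0)
    (hd : dd w F = 0) : False := by
  have h1 : ∀ j, eval w (pderiv j F) = 0 := fun j =>
    eval_zero_of_dd (n := e + 2) h.hF.pderiv (by rw [dd_pd, hd, map_zero])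
  obtain ⟨c, hc⟩ := h.nod w hw h1 (Pi.single i 1) (by
    intro j
    refine Finset.sum_eq_zero fun k _ => ?_
    rw [eval_zero_of_dd (n := e + 1) h.hF.pderiv.pderiv (by rw [dd_pd, dd_pd, hd, map_zero, map_zero]),
      mul_zero])
  have := congrFun hc i
  simp [hi] at this

lemma Ctx.exists_pd {e : ℕ} {F : S3} (h : Ctx e F) : ∃ k, pderiv k F ≠ 0 := by
  by_contra hcon
  push Not at hcon
  have := h.hF.sum_X_mul_pderiv
  simp [hcon] at this
  rcases this with h1 | h1
  · norm_cast at h1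
  · exact h.hirr.ne_zero h1

lemma Ctx.not_dvd_lt {e : ℕ} {F : S3} (h : Ctx e F) {u : S3} {k : ℕ} (hu : u.IsHomogeneous k)
    (hk : k < e + 4) (h0 : u ≠ 0) : ¬ F ∣ u := fun hd => h0 (hom_dvd_lt h.hF hu hd hk)

lemma sum3 {M : Type} [AddCommMonoid M] {i j k : Fin 3} (hij : i ≠ j) (hik : i ≠ k)
    (hjk : j ≠ k) (f : Fin 3 → M) : ∑ a, f a = f i + f j + f k := by
  have : (Finset.univ : Finset (Fin 3)) = {i, j, k} := by
    revert i j k; decide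
  rw [this, Finset.sum_insert (by simp [hij, hik]), Finset.sum_insert (by simp [hjk]),
    Finset.sum_singleton, add_assoc]

/-- The flex polynomial. -/
def flexP (j k : Fin 3) (F : S3) : S3 :=
  pderiv k F ^ 2 * pderiv j (pderiv j F) - 2 * pderiv j F * pderiv k F * pderiv j (pderiv k F)
    + pderiv j F ^ 2 * pderiv k (pderiv k F)

lemma Ctx.flex_not_dvd {e : ℕ} {F : S3} (h : Ctx e F) {i j k : Fin 3} (hij : i ≠ j) (hik : i ≠ k)
    (hjk : j ≠ k) (hk : pderiv k F ≠ 0) : ¬ F ∣ flexP j k F := by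
  intro hdvd
  have hFk : (pderiv k F).IsHomogeneous (e + 3) := h.hF.pderiv
  have hFj : (pderiv j F).IsHomogeneous (e + 3) := h.hF.pderiv
  have hndvd : ¬ F ∣ X i * pderiv k F := by
    intro h'
    rcases h.hirr.prime.dvd_or_dvd h' with h' | h'
    · exact h.not_dvd_lt (isHomogeneous_X _ _) (by omega) (X_ne_zero _) h'
    · exact h.not_dvd_lt hFk (by omega) hk h'
  obtain ⟨p, hpF, hp⟩ := exists_zero_ne h.hirr.prime hndvd
  rw [map_mul, eval_X] at hp
  have hpi : p i ≠ 0 := left_ne_zero_of_mul hp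
  have hpk : eval p (pderiv k F) ≠ 0 := right_ne_zero_of_mul hp
  have hp0 : p ≠ 0 := fun h0 => hpi (by simp [h0])
  set a := eval p (pderiv k F) with ha
  set b := eval p (pderiv j F) with hb
  set g : S3 := C a * pderiv j F - C b * pderiv k F with hg
  have hghom : g.IsHomogeneous (e + 3) := (hFj.C_mul _).sub (hFk.C_mul _)
  have hgp : eval p g = 0 := by simp [hg, ← ha, ← hb]; ring
  by_cases hFg : F ∣ g
  · have hg0 : g = 0 := hom_dvd_lt h.hF hghom hFg (by omega)
    refine h.no_dir (w := Pi.single j a - Pi.single k b) ?_ i ?_ ?_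
    · intro h0
      have := congrFun h0 j
      simp [hjk] at this
      exact hpk this
    · simp [hij, hik]
    · rw [dd_apply, ← hg0, hg]
      rw [sum3 hij hik hjk]
      simp [hij, hik, hjk, hjk.symm]
      ring
  · set P := lineI p with hP
    set I : Ideal S3 := Ideal.span {F, g} with hI
    let D : Derivation ℂ S3 S3 := pderiv k F • pderiv j - pderiv j F • pderiv k
    have hD : ∀ u, D u = pderiv k F * pderiv j u - pderiv j F * pderiv k u := fun u => by
      simp [D]
    have hFI : F ∈ I := Ideal.subset_span (by simp)
    have hgI : g ∈ I := Ideal.subset_span (by simp)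
    have hIP : I ≤ P := by
      rw [hI, Ideal.span_le]
      rintro x (rfl | rfl)
      · exact (mem_lineI_hom h.hF).2 hpF
      · exact (mem_lineI_hom hghom).2 hgp
    have hDg : pderiv k F * D g ∈ I := by
      have : pderiv k F * D g = C a * flexP j k F + g * D (pderiv k F) := by
        simp only [hg, map_sub, hD, Derivation.leibniz, pderiv_C, smul_eq_mul, flexP]
        rw [pd_comm k j]
        ring
      rw [this]
      exact I.add_mem (I.mul_mem_left _ (I.mem_of_dvd hdvd hFI)) (I.mul_mem_right _ hgI)
    have hDI : ∀ x ∈ I, pderiv k F * D x ∈ I := by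
      intro x hx
      obtain ⟨u, v, rfl⟩ := Ideal.mem_span_pair.1 hx
      have hDF : D F = 0 := by rw [hD]; ring
      have : pderiv k F * D (u * F + v * g) =
          (pderiv k F * D u) * F + (pderiv k F * D v) * g + v * (pderiv k F * D g) := by
        simp only [map_add, Derivation.leibniz, smul_eq_mul, hDF]; ring
      rw [this]
      exact I.add_mem (I.add_mem (I.mul_mem_left _ hFI) (I.mul_mem_left _ hgI))
        (I.mul_mem_left _ hDg)
    set lam : S3 := C (p i) * X j - C (p j) * X i with hlam
    have hlamP : lam ∈ P := by
      rw [hP, mem_lineI_hom (cross_hom _ _ _)]; simp; ring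
    have hDlam : D lam = C (p i) * pderiv k F := by
      simp only [hlam, hD, map_sub, Derivation.leibniz, pderiv_C, smul_eq_mul]
      rw [pderiv_X_self, pderiv_X_of_ne hij.symm.symm, pderiv_X_of_ne hjk, pderiv_X_of_ne hik]
      ring
    have key : ∀ m : ℕ, ∀ s, s ∉ P → s * lam ^ m ∈ I → False := by
      intro m
      induction m with
      | zero => intro s hs hm; exact hs (hIP (by simpa using hm))
      | succ m ih =>
        intro s hs hm
        refine ih (s ^ 2 * pderiv k F ^ 2 * C (p i) * C ((m + 1 : ℕ) : ℂ)) ?_ ?_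
        · have hFkP : pderiv k F ∉ P := by rw [hP, mem_lineI_hom hFk]; exact hpk
          have hC : ∀ c : ℂ, c ≠ 0 → (C c : S3) ∉ P := by
            intro c hc; rw [hP, mem_lineI_hom (isHomogeneous_C _ _)]; simpa using hc
          have hPp : P.IsPrime := by rw [hP]; infer_instance
          intro hmem
          rcases hPp.mem_or_mem hmem with h1 | h1
          · rcases hPp.mem_or_mem h1 with h1 | h1
            · rcases hPp.mem_or_mem h1 with h1 | h1
              · exact hs (hPp.mem_of_pow_mem _ h1)
              · exact hFkP (hPp.mem_of_pow_mem _ h1)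
            · exact hC _ hpi h1
          · exact hC _ (by exact_mod_cast Nat.succ_ne_zero m) h1
        · have h1 := I.mul_mem_left s (hDI _ hm)
          have h2 := I.mul_mem_left (pderiv k F * D s) hm
          have h3 := I.sub_mem h1 h2
          convert h3 using 1
          rw [Derivation.leibniz, Derivation.leibniz_pow, hDlam]
          simp only [smul_eq_mul, nsmul_eq_mul, Nat.add_sub_cancel]
          push_cast
          simp only [map_add, map_natCast, map_one]
          ring
    have hnd : ¬ Disjoint (I : Set S3) ((P.primeCompl ⊔ Submonoid.powers lam : Submonoid S3) : Set S3) := by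
      intro hdis
      obtain ⟨Q, hQ, hIQ, hQd⟩ := Ideal.exists_le_prime_disjoint _ _ hdis
      have hQP : Q ≤ P := by
        intro x hx
        by_contra hxP
        exact Set.disjoint_left.1 hQd hx ((le_sup_left : P.primeCompl ≤ _) hxP)
      have := lineI_minimal h.hirr h.hF hghom hFg hp0 hpF hgp Q (hIQ hFI) (hIQ hgI) hQP
      have hlQ : lam ∈ Q := by rw [this]; exact hlamP
      exact Set.disjoint_left.1 hQd hlQ
        ((le_sup_right : Submonoid.powers lam ≤ _) (Submonoid.mem_powers _))
    rw [Set.not_disjoint_iff] at hnd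
    obtain ⟨x, hxI, hx⟩ := hnd
    obtain ⟨s, hs, t, ⟨m, rfl⟩, rfl⟩ := Submonoid.mem_sup.1 hx
    exact key m s hs hxI

lemma flex_alg (Fi Fj Fk oi oj ok pi pj pk Hii Hij Hik Hjj Hjk Hkk n : ℂ)
    (e1 : Fi * oi + Fj * oj + Fk * ok = 0) (e2 : Fi * pi + Fj * pj + Fk * pk = 0)
    (hi : Hii * pi + Hij * pj + Hik * pk = n * Fi)
    (hj : Hij * pi + Hjj * pj + Hjk * pk = n * Fj)
    (hk : Hik * pi + Hjk * pj + Hkk * pk = n * Fk)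
    (hoo : Hii * oi ^ 2 + Hjj * oj ^ 2 + Hkk * ok ^ 2 + 2 * Hij * oi * oj + 2 * Hik * oi * ok
      + 2 * Hjk * oj * ok = 0)
    (hne : oj * pk - ok * pj ≠ 0 ∨ ok * pi - oi * pk ≠ 0 ∨ oi * pj - oj * pi ≠ 0) :
    Fk ^ 2 * Hjj - 2 * Fj * Fk * Hjk + Fj ^ 2 * Hkk = 0 := by
  obtain ⟨μ, h1, h2, h3⟩ : ∃ μ, Fi = μ * (oj * pk - ok * pj) ∧ Fj = μ * (ok * pi - oi * pk) ∧
      Fk = μ * (oi * pj - oj * pi) := by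
    rcases hne with h | h | h
    · refine ⟨Fi / (oj * pk - ok * pj), ?_, ?_, ?_⟩ <;> field_simp
      · linear_combination pk * e1 - ok * e2
      · linear_combination (-pj) * e1 + oj * e2
    · refine ⟨Fj / (ok * pi - oi * pk), ?_, ?_, ?_⟩ <;> field_simp
      · linear_combination (-pk) * e1 + ok * e2
      · linear_combination pi * e1 - oi * e2
    · refine ⟨Fk / (oi * pj - oj * pi), ?_, ?_, ?_⟩ <;> field_simp
      · linear_combination pj * e1 - oj * e2
      · linear_combination (-pi) * e1 + oi * e2
  -- τ = Fk e_j - Fj e_k = μ (p_j o_i - ..)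
  have hpp : Hii * pi ^ 2 + Hjj * pj ^ 2 + Hkk * pk ^ 2 + 2 * Hij * pi * pj + 2 * Hik * pi * pk
      + 2 * Hjk * pj * pk = 0 := by
    linear_combination pi * hi + pj * hj + pk * hk + n * e2
  have hop : oi * (Hii * pi + Hij * pj + Hik * pk) + oj * (Hij * pi + Hjj * pj + Hjk * pk)
      + ok * (Hik * pi + Hjk * pj + Hkk * pk) = 0 := by
    linear_combination oi * hi + oj * hj + ok * hk + n * e1
  rw [h2, h3]
  linear_combination μ ^ 2 * (oi ^ 2 * hpp - 2 * oi * pi * hop + pi ^ 2 * hoo)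

lemma Ctx.flex {e : ℕ} {F : S3} (h : Ctx e F) : ∃ (Φ : S3) (m : ℕ), Φ.IsHomogeneous m ∧ ¬ F ∣ Φ ∧
    ∀ p o : V3, eval p F = 0 → eval p (dd o F) = 0 → eval p (dd o (dd o F)) = 0 →
      (¬ ∃ c : ℂ, o = c • p) → p ≠ 0 → eval p Φ = 0 := by
  obtain ⟨k, hk⟩ := h.exists_pd
  obtain ⟨i, j, hij, hik, hjk⟩ : ∃ i j : Fin 3, i ≠ j ∧ i ≠ k ∧ j ≠ k := by
    clear hk; revert k; decide
  refine ⟨flexP j k F, 3 * e + 8, ?_, h.flex_not_dvd hij hik hjk hk, ?_⟩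
  · have hFk : (pderiv k F).IsHomogeneous (e + 3) := h.hF.pderiv
    have hFj : (pderiv j F).IsHomogeneous (e + 3) := h.hF.pderiv
    have h2 : ∀ a b, (pderiv a (pderiv b F)).IsHomogeneous (e + 2) := fun a b => h.hF.pderiv.pderiv
    unfold flexP
    refine IsHomogeneous.add (n := 3 * e + 8) (IsHomogeneous.sub (n := 3 * e + 8) ?_ ?_) ?_
    · exact hom_cast ((hFk.pow 2).mul (h2 j j)) (by ring)
    · have : (2 : S3) = C 2 := by rw [map_ofNat]
      rw [this]
      exact hom_cast (((hFj.C_mul 2).mul hFk).mul (h2 j k)) (by ring)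
    · exact hom_cast ((hFj.pow 2).mul (h2 k k)) (by ring)
  · intro p o h1 h2 h3 h4 hp
    have E := fun a => euler_eval (h.hF.pderiv (i := a)) p
    have E0 := euler_eval h.hF p
    simp only [dd_apply, map_sum, Derivation.leibniz, pderiv_C, smul_eq_mul] at h2 h3
    simp only [map_add, map_mul, eval_C, map_sum] at h2 h3
    simp only [sum3 hij hik hjk] at h2 h3 E E0
    rw [h1] at E0
    have hpne : o j * p k - o k * p j ≠ 0 ∨ o k * p i - o i * p k ≠ 0 ∨ o i * p j - o j * p i ≠ 0 := by
      by_contra hcon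
      push Not at hcon
      apply h4
      apply parallel_of_cross hp
      have T : ∀ a : Fin 3, a = i ∨ a = j ∨ a = k := by
        clear * - hij hik hjk
        revert i j k; decide
      obtain ⟨c1, c2, c3⟩ := hcon
      intro a b
      rcases T a with rfl | rfl | rfl <;> rcases T b with rfl | rfl | rfl <;>
        first | ring1 | linear_combination c1 | linear_combination c2 | linear_combination c3 |
          linear_combination (-1) * c1 | linear_combination (-1) * c2 | linear_combination (-1) * c3
    have := flex_alg (eval p (pderiv i F)) (eval p (pderiv j F)) (eval p (pderiv k F)) (o i) (o j) (o k)
      (p i) (p j) (p k) (eval p (pderiv i (pderiv i F))) (eval p (pderiv i (pderiv j F)))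
      (eval p (pderiv i (pderiv k F))) (eval p (pderiv j (pderiv j F))) (eval p (pderiv j (pderiv k F)))
      (eval p (pderiv k (pderiv k F))) ((e + 4 - 1 : ℕ) : ℂ)
      (by linear_combination h2) (by linear_combination E0)
      (by have := E i; rw [pd_comm j i, pd_comm k i] at this; linear_combination this)
      (by have := E j; rw [pd_comm k j] at this; linear_combination this)
      (by have := E k; linear_combination this)
      (by rw [pd_comm j i, pd_comm k i, pd_comm k j] at h3; simp at h3; linear_combination h3) hpne
    simp only [flexP, map_add, map_sub, map_mul, map_pow]
    simpa using this


lemma avoid {σ : Type} [Finite σ] (B : Finset (MvPolynomial σ ℂ)) (hB : ∀ f ∈ B, f ≠ 0) :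
    ∃ o : σ → ℂ, ∀ f ∈ B, eval o f ≠ 0 := by
  have h : (∏ f ∈ B, f) ≠ 0 := Finset.prod_ne_zero_iff.2 hB
  have : ∃ o : σ → ℂ, eval o (∏ f ∈ B, f) ≠ 0 := by
    by_contra hcon
    push Not at hcon
    exact h (MvPolynomial.funext (by simpa using hcon))
  obtain ⟨o, ho⟩ := this
  refine ⟨o, fun f hf h0 => ho ?_⟩
  rw [map_prod]
  exact Finset.prod_eq_zero hf h0

/-- `p` singular. -/
def Sg (F : S3) (p : V3) : Prop := ∀ i, eval p (pderiv i F) = 0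

lemma Sg.smul {F : S3} {n : ℕ} (hF : F.IsHomogeneous n) {p : V3} {c : ℂ} (h : Sg F p) :
    Sg F (c • p) := fun i => by rw [hom_eval_smul hF.pderiv, h i, mul_zero]

def linF (v : V3) : S3 := ∑ i, C (v i) * X i

lemma linF_hom (v : V3) : (linF v).IsHomogeneous 1 :=
  IsHomogeneous.sum _ _ _ fun i _ => isHomogeneous_C_mul_X _ _

lemma eval_linF (v p : V3) : eval p (linF v) = ∑ i, v i * p i := by simp [linF]

lemma linF_ne {v : V3} (hv : v ≠ 0) : linF v ≠ 0 := by
  intro h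
  apply hv
  funext i
  have := congrArg (eval (Pi.single i 1)) h
  simpa [eval_linF, Pi.single_apply] using this

lemma Ctx.exists_l {e : ℕ} {F : S3} (h : Ctx e F) : ∃ b c : ℂ, ∀ p : V3, p ≠ 0 → Sg F p →
    p 0 + b * p 1 + c * p 2 ≠ 0 := by
  classical
  obtain ⟨B, hB, hB2⟩ := h.fin
  obtain ⟨m, hm⟩ := avoid (insert (X 0) (B.image linF)) (by
    intro f hf
    rcases Finset.mem_insert.1 hf with rfl | hf
    · exact X_ne_zero _
    · obtain ⟨b, hb, rfl⟩ := Finset.mem_image.1 hf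
      exact linF_ne (hB b hb).1)
  have h0 : m 0 ≠ 0 := by simpa using hm (X 0) (by simp)
  refine ⟨m 1 / m 0, m 2 / m 0, fun p hp hs => ?_⟩
  obtain ⟨b, hb, c, hc, rfl⟩ := hB2 p hp hs
  have h1 := hm (linF b) (by simp; right; exact ⟨b, hb, rfl⟩)
  rw [eval_linF, Fin.sum_univ_three] at h1
  intro h2
  apply h1
  simp only [Pi.smul_apply, smul_eq_mul] at h2
  field_simp at h2
  have h3 : b 0 * m 0 + b 1 * m 1 + b 2 * m 2 = 0 := by
    have : c * (b 0 * m 0 + b 1 * m 1 + b 2 * m 2) = 0 := by linear_combination h2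
    exact (mul_eq_zero.1 this).resolve_left hc
  exact h3

lemma eval_dd2 (o p : V3) (f : S3) : eval p (dd o (dd o f)) =
    ∑ i, ∑ j, o i * o j * eval p (pderiv j (pderiv i f)) := by
  rw [eval_dd]
  refine Finset.sum_congr rfl fun i _ => ?_
  rw [← dd_pd, eval_dd, Finset.mul_sum]
  refine Finset.sum_congr rfl fun j _ => ?_
  ring

/-- second-order form at a point as polynomial in direction -/
def quadF (F : S3) (p : V3) : S3 :=
  ∑ i, ∑ j, X i * X j * C (eval p (pderiv j (pderiv i F)))

lemma eval_quadF (F : S3) (o p : V3) : eval o (quadF F p) = eval p (dd o (dd o F)) := by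
  rw [eval_dd2]; simp [quadF]

lemma Ctx.quad_ne {e : ℕ} {F : S3} (h : Ctx e F) {p : V3} (hp : p ≠ 0) (hs : Sg F p) :
    quadF F p ≠ 0 := by
  intro h0
  have hq : ∀ o : V3, ∑ i, ∑ j, o i * o j * eval p (pderiv j (pderiv i F)) = 0 := fun o => by
    rw [← eval_dd2, ← eval_quadF, h0, map_zero]
  have hd : ∀ i, eval p (pderiv i (pderiv i F)) = 0 := fun i => by
    have := hq (Pi.single i 1)
    simpa [Pi.single_apply] using this
  have hH : ∀ i j, eval p (pderiv j (pderiv i F)) = 0 := by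
    intro i j
    by_cases hij : i = j
    · subst hij; exact hd i
    have := hq (Pi.single i 1 + Pi.single j 1)
    simp [Pi.single_apply, add_mul, mul_add, Finset.sum_add_distrib, hd] at this
    rw [pd_comm i j] at this
    linear_combination this / 2
  have hn := fun v : V3 => h.nod p hp hs v (fun i => Finset.sum_eq_zero fun j _ => by rw [hH, mul_zero])
  obtain ⟨c0, h0⟩ := hn (Pi.single 0 1)
  obtain ⟨c1, h1⟩ := hn (Pi.single 1 1)
  have a0 := congrFun h0 0
  have a1 := congrFun h0 1
  have b1 := congrFun h1 1
  simp at a0 a1 b1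
  rcases a1 with a1 | a1
  · simp [a1] at a0
  · simp [a1] at b1

structure Su (e : ℕ) (F : S3) (b c : ℂ) (o : V3) : Prop extends Ctx e F where
  lD : ∀ p : V3, p ≠ 0 → Sg F p → p 0 + b * p 1 + c * p 2 ≠ 0
  o1 : eval o F ≠ 0
  o2 : ∀ p : V3, p ≠ 0 → eval p F = 0 → eval p (dd o F) = 0 → eval p (dd o (dd o F)) ≠ 0
  o3 : ∀ p : V3, p ≠ 0 → eval p F = 0 → p 0 + b * p 1 + c * p 2 = 0 → eval p (dd o F) ≠ 0

lemma Ctx.exists_Su {e : ℕ} {F : S3} (h : Ctx e F) : ∃ b c o, Su e F b c o := by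
  classical
  obtain ⟨b, c, hl⟩ := h.exists_l
  obtain ⟨Φ, m, hΦ, hΦF, hflex⟩ := h.flex
  obtain ⟨BD, hBD, hBD2⟩ := h.fin
  have hlin : ∀ p, eval p (linF ![1, b, c]) = p 0 + b * p 1 + c * p 2 := fun p => by
    simp [eval_linF, Fin.sum_univ_three]
  have hFl : ¬ F ∣ linF ![1, b, c] := h.not_dvd_lt (linF_hom _) (by omega)
    (linF_ne (fun h0 => by simpa using congrFun h0 0))
  obtain ⟨B1, hB1, hB1'⟩ := finite_common_zeros h.hirr h.hF (linF_hom _) hFl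
  obtain ⟨B2, hB2, hB2'⟩ := finite_common_zeros h.hirr h.hF hΦ hΦF
  let gr : V3 → S3 := fun p => linF fun i => eval p (pderiv i F)
  have hgr : ∀ p o, eval o (gr p) = eval p (dd o F) := fun p o => by
    rw [eval_dd, eval_linF]; simp [mul_comm]
  have hgrne : ∀ p, ¬ Sg F p → gr p ≠ 0 := by
    intro p hp
    apply linF_ne
    intro h0
    exact hp fun i => congrFun h0 i
  obtain ⟨o, ho⟩ := avoid (insert F ((BD.image (quadF F)) ∪ ((B1 ∪ B2).filter fun p => ¬ Sg F p).image gr)) (by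
    intro f hf
    rcases Finset.mem_insert.1 hf with rfl | hf
    · exact h.hirr.ne_zero
    rcases Finset.mem_union.1 hf with hf | hf
    · obtain ⟨p, hp, rfl⟩ := Finset.mem_image.1 hf
      exact h.quad_ne (hBD p hp).1 (hBD p hp).2
    · obtain ⟨p, hp, rfl⟩ := Finset.mem_image.1 hf
      exact hgrne p (Finset.mem_filter.1 hp).2)
  have o1 : eval o F ≠ 0 := ho F (by simp)
  have oD : ∀ p ∈ BD, eval p (dd o (dd o F)) ≠ 0 := fun p hp => by
    rw [← eval_quadF]
    exact ho _ (Finset.mem_insert_of_mem (Finset.mem_union_left _ (Finset.mem_image_of_mem _ hp)))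
  have oB : ∀ p ∈ B1 ∪ B2, ¬ Sg F p → eval p (dd o F) ≠ 0 := fun p hp hs => by
    rw [← hgr]
    exact ho _ (Finset.mem_insert_of_mem (Finset.mem_union_right _ (Finset.mem_image_of_mem _
      (Finset.mem_filter.2 ⟨hp, hs⟩))))
  refine ⟨b, c, o, h, hl, o1, ?_, ?_⟩
  · intro p hp h1 h2 h3
    by_cases hs : Sg F p
    · obtain ⟨q, hq, t, ht, rfl⟩ := hBD2 p hp hs
      rw [hom_eval_smul (dd_hom (dd_hom h.hF))] at h3
      exact oD q hq ((mul_eq_zero.1 h3).resolve_left (pow_ne_zero _ ht))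
    · have hΦp := hflex p o h1 h2 h3 (by
        rintro ⟨t, rfl⟩
        apply o1
        rw [hom_eval_smul h.hF, h1, mul_zero]) hp
      obtain ⟨q, hq, t, ht, rfl⟩ := hB2' p hp h1 hΦp
      rw [hom_eval_smul (dd_hom h.hF)] at h2
      exact oB q (Finset.mem_union_right _ hq) (fun hsq => hs (hsq.smul h.hF))
        ((mul_eq_zero.1 h2).resolve_left (pow_ne_zero _ ht))
  · intro p hp h1 h2 h3
    have hs : ¬ Sg F p := fun hs => hl p hp hs h2
    obtain ⟨q, hq, t, ht, rfl⟩ := hB1' p hp h1 (by rw [hlin]; exact h2)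
    rw [hom_eval_smul (dd_hom h.hF)] at h3
    exact oB q (Finset.mem_union_left _ hq) (fun hsq => hs (hsq.smul h.hF))
        ((mul_eq_zero.1 h3).resolve_left (pow_ne_zero _ ht))


abbrev T2 : Type := MvPolynomial (Fin 2) ℂ

lemma finrank_T2 (m : ℕ) : Module.finrank ℂ (homogeneousSubmodule (Fin 2) ℂ m) = m + 1 := by
  have h1 : homogeneousSubmodule (Fin 2) ℂ m = restrictSupport ℂ {d | d.degree = m} :=
    homogeneousSubmodule_eq_finsupp_supported _ _ _
  rw [h1, Module.finrank_eq_nat_card_basis (basisRestrictSupport ℂ _)]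
  have e : {d : Fin 2 →₀ ℕ | d.degree = m} ≃ Fin (m + 1) :=
    { toFun := fun d => ⟨d.1 0, by
        have := d.2
        simp only [Set.mem_setOf_eq, Finsupp.degree_eq_sum, Fin.sum_univ_two] at this
        omega⟩
      invFun := fun i => ⟨Finsupp.equivFunOnFinite.symm ![i.1, m - i.1], by
        simp only [Set.mem_setOf_eq, Finsupp.degree_eq_sum, Fin.sum_univ_two]
        simp; omega⟩
      left_inv := by
        rintro ⟨d, hd⟩
        simp only [Set.mem_setOf_eq, Finsupp.degree_eq_sum, Fin.sum_univ_two] at hd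
        ext i
        fin_cases i
        · simp
        · simp; omega
      right_inv := by
        rintro ⟨i, hi⟩
        simp }
  rw [Nat.card_congr e]; simp

instance (m : ℕ) : Module.Finite ℂ (homogeneousSubmodule (Fin 2) ℂ m) :=
  Module.Finite.iff_fg.2 (homogeneousSubmodule_fg _ _ _)

instance finS3 (m : ℕ) : Module.Finite ℂ (homogeneousSubmodule (Fin 3) ℂ m) :=
  Module.Finite.iff_fg.2 (homogeneousSubmodule_fg _ _ _)

structure Bin (e : ℕ) (P Q : T2) : Prop where
  hP : P.IsHomogeneous (e + 4)
  hQ : Q.IsHomogeneous (e + 3)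
  hrel : IsRelPrime P Q

lemma X_ndvd {i j : Fin 2} (h : i ≠ j) : ¬ (X i : T2) ∣ X j := by
  intro hd
  have := (X_dvd_X (R := ℂ) (i := i) (j := j)).1 hd
  simp_all

lemma relPrime_of_zeros {P Q : T2} (h : ∀ p, eval p P = 0 → eval p Q = 0 → p = 0) :
    IsRelPrime P Q := by
  intro π h1 h2
  have hX : ∀ i, ∃ n : ℕ, π ∣ (X i : T2) ^ n := by
    intro i
    have := vanishingIdeal_zeroLocus_eq_radical (K := ℂ) (Ideal.span {P, Q})
    have hm : (X i : T2) ∈ (Ideal.span {P, Q}).radical := by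
      rw [← this, mem_vanishingIdeal_iff]
      intro x hx
      rw [mem_zeroLocus_iff] at hx
      have e1 := hx P (Ideal.subset_span (by simp))
      have e2 := hx Q (Ideal.subset_span (by simp))
      have := h x (by simpa [aeval_eq_eval] using e1) (by simpa [aeval_eq_eval] using e2)
      simp [this]
    obtain ⟨n, hn⟩ := hm
    obtain ⟨u, v, huv⟩ := Ideal.mem_span_pair.1 hn
    exact ⟨n, huv ▸ dvd_add (h1.mul_left _) (h2.mul_left _)⟩
  obtain ⟨n, hn⟩ := hX 0
  obtain ⟨m, hm⟩ := hX 1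
  have h0 : Prime (X 0 : T2) := X_prime
  have h1 : Prime (X 1 : T2) := X_prime
  obtain ⟨i, -, hi⟩ := (dvd_prime_pow h0 n).1 hn
  rcases Nat.eq_zero_or_pos i with rfl | hpos
  · simpa using hi.isUnit_iff.2 (by simp)
  · exfalso
    have : (X 0 : T2) ∣ X 1 ^ m := ((dvd_pow_self _ hpos.ne').trans hi.symm.dvd).trans hm
    exact X_ndvd (by decide) (h0.dvd_of_dvd_pow this)

lemma not_unit_hom {σ : Type} {u : MvPolynomial σ ℂ} {n : ℕ} (hu : u.IsHomogeneous (n + 1)) : ¬ IsUnit u := by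
  intro h
  have h1 := h.map (eval (0 : σ → ℂ))
  have : eval (0 : σ → ℂ) u = 0 := by
    have h2 := hu.coeff_eq_zero (d := 0) (by simp)
    rw [← h2, ← constantCoeff_eq, ← eval_zero]
  rw [this] at h1
  simp at h1

namespace Bin
variable {e : ℕ} {P Q : T2}

lemma P_ne (h : Bin e P Q) : P ≠ 0 := by
  rintro rfl
  exact not_unit_hom (n := e + 2) h.hQ (isRelPrime_zero_left.1 h.hrel)

lemma Q_ne (h : Bin e P Q) : Q ≠ 0 := by
  rintro rfl
  exact not_unit_hom (n := e + 3) h.hP (isRelPrime_zero_right.1 h.hrel)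

lemma syz (h : Bin e P Q) {α β : T2} (h0 : α * P + β * Q = 0) : ∃ c, α = c * Q ∧ β = - (c * P) := by
  have hd : Q ∣ α * P := ⟨-β, by linear_combination h0⟩
  obtain ⟨c, rfl⟩ := h.hrel.symm.dvd_of_dvd_mul_right hd
  refine ⟨c, mul_comm _ _, ?_⟩
  have : (β + c * P) * Q = 0 := by linear_combination h0
  have := (mul_eq_zero.1 this).resolve_right h.Q_ne
  linear_combination this

lemma syz0 (h : Bin e P Q) {α β : T2} {k : ℕ} (hk : k < e + 3) (hα : α.IsHomogeneous k) (h0 : α * P + β * Q = 0) :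
    α = 0 ∧ β = 0 := by
  obtain ⟨c, h1, h2⟩ := h.syz h0
  have : α = 0 := hom_dvd_lt h.hQ hα ⟨c, by rw [h1, mul_comm]⟩ hk
  refine ⟨this, ?_⟩
  rw [this, zero_mul, zero_add] at h0
  exact (mul_eq_zero.1 h0).resolve_right h.Q_ne

def phi (h : Bin e P Q) (i j m : ℕ) (h1 : i + (e + 4) = m) (h2 : j + (e + 3) = m) :
    (homogeneousSubmodule (Fin 2) ℂ i × homogeneousSubmodule (Fin 2) ℂ j) →ₗ[ℂ]
      homogeneousSubmodule (Fin 2) ℂ m where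
  toFun x := ⟨x.1.1 * P + x.2.1 * Q, by
    refine IsHomogeneous.add ?_ ?_
    · exact hom_cast (IsHomogeneous.mul x.1.2 h.hP) h1
    · exact hom_cast (IsHomogeneous.mul x.2.2 h.hQ) h2⟩
  map_add' x y := by ext1; simp; ring
  map_smul' c x := by ext1; simp

lemma phi_inj (h : Bin e P Q) (i j m : ℕ) (h1 : i + (e + 4) = m) (h2 : j + (e + 3) = m) (hi : i < e + 3) :
    Function.Injective (h.phi i j m h1 h2) := by
  rw [injective_iff_map_eq_zero]
  rintro ⟨⟨a, ha⟩, ⟨b, hb⟩⟩ hx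
  have hx' : a * P + b * Q = 0 := congrArg Subtype.val hx
  obtain ⟨rfl, rfl⟩ := h.syz0 hi ha hx'
  rfl

lemma top (h : Bin e P Q) {u : T2} (hu : u.IsHomogeneous (2 * e + 6)) : u ∈ Ideal.span {P, Q} := by
  have hinj := h.phi_inj (e + 2) (e + 3) (2 * e + 6) (by ring) (by ring) (by omega)
  have hs := (LinearMap.injective_iff_surjective_of_finrank_eq_finrank (by
    rw [Module.finrank_prod, finrank_T2, finrank_T2, finrank_T2]; ring)).1 hinj
  obtain ⟨⟨a, b⟩, hab⟩ := hs ⟨u, hu⟩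
  rw [Ideal.mem_span_pair]
  exact ⟨a.1, b.1, congrArg Subtype.val hab⟩

lemma codim (h : Bin e P Q) : ∃ w : T2, w.IsHomogeneous (2 * e + 5) ∧ w ∉ Ideal.span {P, Q} ∧
    ∀ u : T2, u.IsHomogeneous (2 * e + 5) → ∃ c : ℂ, u - C c * w ∈ Ideal.span {P, Q} := by
  have hinj := h.phi_inj (e + 1) (e + 2) (2 * e + 5) (by ring) (by ring) (by omega)
  set f := h.phi (e + 1) (e + 2) (2 * e + 5) (by ring) (by ring) with hf
  have h1 := LinearMap.finrank_range_of_inj hinj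
  rw [Module.finrank_prod, finrank_T2, finrank_T2] at h1
  have h2 := Submodule.finrank_quotient_add_finrank (LinearMap.range f)
  rw [finrank_T2] at h2
  have h3 : Module.finrank ℂ (homogeneousSubmodule (Fin 2) ℂ (2 * e + 5) ⧸ LinearMap.range f) = 1 := by
    omega
  obtain ⟨v, hv, hall⟩ := finrank_eq_one_iff'.1 h3
  obtain ⟨w, rfl⟩ := Submodule.mkQ_surjective _ v
  refine ⟨w.1, w.2, ?_, ?_⟩
  · intro hw
    apply hv
    obtain ⟨a, b, hab⟩ := Ideal.mem_span_pair.1 hw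
    obtain ⟨a', b', h4, h5, h6, -, -⟩ := hom_rep2 h.hP h.hQ w.2 hab.symm
    rw [Submodule.mkQ_apply, Submodule.Quotient.mk_eq_zero]
    exact ⟨⟨⟨a', hom_cast h5 (by omega)⟩, ⟨b', hom_cast h6 (by omega)⟩⟩, Subtype.ext h4.symm⟩
  · intro u hu
    obtain ⟨c, hc⟩ := hall (Submodule.mkQ _ ⟨u, hu⟩)
    refine ⟨c, ?_⟩
    rw [← map_smul, ← sub_eq_zero, ← map_sub, Submodule.mkQ_apply, Submodule.Quotient.mk_eq_zero] at hc
    obtain ⟨⟨a, b⟩, hab⟩ := hc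
    have : a.1 * P + b.1 * Q = c • w.1 - u := congrArg Subtype.val hab
    rw [Ideal.mem_span_pair]
    refine ⟨-a.1, -b.1, ?_⟩
    rw [smul_eq_C_mul] at this
    linear_combination -this

lemma socle (h : Bin e P Q) {v : T2} {k : ℕ} (hk : k ≤ 2 * e + 4) (hv : v.IsHomogeneous k)
    (h0 : X 0 * v ∈ Ideal.span {P, Q}) (h1 : X 1 * v ∈ Ideal.span {P, Q}) :
    v ∈ Ideal.span {P, Q} := by
  obtain ⟨a, b, hab⟩ := Ideal.mem_span_pair.1 h0
  obtain ⟨c, d, hcd⟩ := Ideal.mem_span_pair.1 h1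
  have hX : ∀ i, (X i * v : T2).IsHomogeneous (k + 1) := fun i =>
    hom_cast ((isHomogeneous_X _ _).mul hv) (by ring)
  obtain ⟨α, β, e1, e2, -, -, -⟩ := hom_rep2 h.hP h.hQ (hX 0) hab.symm
  obtain ⟨γ, δ, e3, e4, -, -, -⟩ := hom_rep2 h.hP h.hQ (hX 1) hcd.symm
  obtain ⟨s1, s2⟩ := h.syz0 (α := X 1 * α - X 0 * γ) (β := X 1 * β - X 0 * δ)
    (k := 1 + (k + 1 - (e + 4))) (by omega)
    (((isHomogeneous_X _ _).mul e2).sub ((isHomogeneous_X _ _).mul e4))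
    (by linear_combination (-X 1) * e1 + X 0 * e3)
  have hp : Prime (X 0 : T2) := X_prime
  have hα : (X 0 : T2) ∣ α := (hp.dvd_or_dvd (a := X 1) ⟨γ, by linear_combination s1⟩).resolve_left
    (X_ndvd (by decide))
  have hβ : (X 0 : T2) ∣ β := (hp.dvd_or_dvd (a := X 1) ⟨δ, by linear_combination s2⟩).resolve_left
    (X_ndvd (by decide))
  obtain ⟨α', rfl⟩ := hα
  obtain ⟨β', rfl⟩ := hβ
  rw [Ideal.mem_span_pair]
  refine ⟨α', β', ?_⟩
  apply mul_left_cancel₀ hp.ne_zero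
  linear_combination -e1
end Bin


def ell (b c : ℂ) : S3 := X 0 + C b * X 1 + C c * X 2
lemma ell_hom (b c : ℂ) : (ell b c).IsHomogeneous 1 :=
  ((isHomogeneous_X _ _).add (isHomogeneous_C_mul_X _ _)).add (isHomogeneous_C_mul_X _ _)
lemma eval_ell (b c : ℂ) (p : V3) : eval p (ell b c) = p 0 + b * p 1 + c * p 2 := by simp [ell]

def th (b c : ℂ) : S3 →ₐ[ℂ] T2 := aeval ![-(C b * X 0 + C c * X 1), X 0, X 1]
def io : T2 →ₐ[ℂ] S3 := aeval ![X 1, X 2]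

lemma th_ell (b c : ℂ) : th b c (ell b c) = 0 := by
  simp [th, ell, algebraMap_eq]

lemma th_io (b c : ℂ) (v : T2) : th b c (io v) = v := by
  have : (th b c).comp io = AlgHom.id ℂ T2 := by
    apply MvPolynomial.algHom_ext
    intro i
    fin_cases i <;> simp [th, io]
  exact congrArg (fun f : T2 →ₐ[ℂ] T2 => f v) this

lemma io_th (b c : ℂ) (u : S3) : ell b c ∣ u - io (th b c u) := by
  induction u using MvPolynomial.induction_on with
  | C a => simp [th, io, algebraMap_eq]
  | add p q hp hq =>
    rw [map_add, map_add]
    convert dvd_add hp hq using 1; ring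
  | mul_X p n hp =>
    have hX : ell b c ∣ X n - io (th b c (X n)) := by
      fin_cases n
      · refine ⟨1, ?_⟩
        simp [th, io, ell, algebraMap_eq]
        ring
      · simp [th, io]
      · simp [th, io]
    rw [map_mul, map_mul]
    have := dvd_add (hp.mul_right (X n)) (hX.mul_left (io (th b c p)))
    convert this using 1; ring

lemma th_hom (b c : ℂ) {u : S3} {n : ℕ} (hu : u.IsHomogeneous n) : (th b c u).IsHomogeneous n := by
  refine hom_cast (hu.aeval (n := 1) _ ?_) (by ring)
  intro i
  fin_cases i
  · exact ((isHomogeneous_C_mul_X _ _).add (isHomogeneous_C_mul_X _ _)).neg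
  · exact isHomogeneous_X _ _
  · exact isHomogeneous_X _ _

lemma io_hom {u : T2} {n : ℕ} (hu : u.IsHomogeneous n) : (io u).IsHomogeneous n := by
  refine hom_cast (hu.aeval (n := 1) _ ?_) (by ring)
  intro i
  fin_cases i
  · exact isHomogeneous_X _ _
  · exact isHomogeneous_X _ _

lemma eval_th (b c : ℂ) (u : S3) (q : Fin 2 → ℂ) :
    eval q (th b c u) = eval ![-(b * q 0 + c * q 1), q 0, q 1] u := by
  induction u using MvPolynomial.induction_on with
  | C a => simp [th, algebraMap_eq]
  | add p q hp hq => rw [map_add, map_add, map_add, hp, hq]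
  | mul_X p n hp =>
    rw [map_mul, map_mul, map_mul, hp]
    congr 1
    fin_cases n <;> simp [th]

/-- membership in `(F, G, ℓ)` -/
def JJ (F : S3) (b c : ℂ) (o : V3) : Set S3 :=
  {u | ∃ α β γ, u = α * F + β * dd o F + γ * ell b c}

/-- membership in `(F, G)` -/
def KK (F : S3) (o : V3) : Ideal S3 := Ideal.span {F, dd o F}

/-- membership in `(F, G, ℓ - 1)` -/
def II (F : S3) (b c : ℂ) (o : V3) : Ideal S3 := Ideal.span {F, dd o F, ell b c - 1}

lemma mem_KK {F : S3} {o : V3} {u : S3} : u ∈ KK F o ↔ ∃ α β, α * F + β * dd o F = u :=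
  Ideal.mem_span_pair

lemma mem_II {F : S3} {b c : ℂ} {o : V3} {u : S3} :
    u ∈ II F b c o ↔ ∃ α β γ, u = α * F + β * dd o F + γ * (ell b c - 1) := by
  unfold II
  rw [Ideal.mem_span_insert]
  constructor
  · rintro ⟨a, z, hz, rfl⟩
    obtain ⟨x, y, rfl⟩ := Ideal.mem_span_pair.1 hz
    exact ⟨a, x, y, by ring⟩
  · rintro ⟨a, x, y, rfl⟩
    exact ⟨a, _, Ideal.mem_span_pair.2 ⟨x, y, rfl⟩, by ring⟩

lemma KK_le_II {F : S3} {b c : ℂ} {o : V3} : KK F o ≤ II F b c o := by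
  intro u hu
  obtain ⟨α, β, rfl⟩ := mem_KK.1 hu
  exact mem_II.2 ⟨α, β, 0, by ring⟩

lemma ell_sub_mem {F : S3} {b c : ℂ} {o : V3} : ell b c - 1 ∈ II F b c o :=
  mem_II.2 ⟨0, 0, 1, by ring⟩

lemma ell_pow_sub_mem {F : S3} {b c : ℂ} {o : V3} (n : ℕ) (u : S3) :
    u * ell b c ^ n - u ∈ II F b c o := by
  have : u * ell b c ^ n - u = u * (ell b c ^ n - 1 ^ n) := by ring
  rw [this]
  exact Ideal.mul_mem_left _ _ (Ideal.mem_of_dvd _ (sub_dvd_pow_sub_pow _ _ _) ell_sub_mem)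

lemma hcomp_KK {e : ℕ} {F : S3} {o : V3} (hF : F.IsHomogeneous (e + 4)) {u : S3}
    (hu : u ∈ KK F o) (n : ℕ) : homogeneousComponent n u ∈ KK F o := by
  have hG : (dd o F).IsHomogeneous (e + 3) := dd_hom hF
  have key : ∀ {f : S3} {m : ℕ} (α), f.IsHomogeneous m → f ∈ KK F o →
      homogeneousComponent n (α * f) ∈ KK F o := by
    intro f m α hf hm
    by_cases hk : n < m
    · rw [hcomp_mul_lt hf _ _ hk]; exact Ideal.zero_mem _
    · have := hcomp_mul hf α (n - m)
      rw [Nat.sub_add_cancel (by omega)] at this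
      rw [this]; exact Ideal.mul_mem_left _ _ hm
  obtain ⟨α, β, rfl⟩ := mem_KK.1 hu
  rw [map_add]
  exact Ideal.add_mem _ (key α hF (Ideal.subset_span (by simp)))
    (key β hG (Ideal.subset_span (by simp)))

namespace Su
variable {e : ℕ} {F : S3} {b c : ℂ} {o : V3}

lemma hG (h : Su e F b c o) : (dd o F).IsHomogeneous (e + 3) := dd_hom h.hF

lemma bin (h : Su e F b c o) : Bin e (th b c F) (th b c (dd o F)) where
  hP := th_hom _ _ h.hF
  hQ := th_hom _ _ h.hG
  hrel := relPrime_of_zeros fun q h1 h2 => by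
    by_contra hq
    rw [eval_th] at h1 h2
    refine h.o3 _ ?_ h1 ?_ h2
    · intro h0
      apply hq
      funext i
      fin_cases i
      · simpa using congrFun h0 1
      · simpa using congrFun h0 2
    · simp

lemma mem_JJ {u : S3} : u ∈ JJ F b c o ↔ th b c u ∈ Ideal.span {th b c F, th b c (dd o F)} := by
  rw [Ideal.mem_span_pair]
  constructor
  · rintro ⟨α, β, γ, rfl⟩
    refine ⟨th b c α, th b c β, ?_⟩
    simp [th_ell]
  · rintro ⟨α, β, hab⟩
    have h1 := io_th b c u
    have h2 := io_th b c (io α * F + io β * dd o F)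
    rw [← hab] at h1
    rw [map_add, map_mul, map_mul, th_io, th_io] at h2
    obtain ⟨γ, hγ⟩ := dvd_sub h1 h2
    exact ⟨io α, io β, γ, by linear_combination hγ⟩

lemma P1 (h : Su e F b c o) {α β : S3} (hd : ell b c ∣ α * F + β * dd o F) :
    ∃ t, ell b c ∣ α - t * dd o F ∧ ell b c ∣ β + t * F := by
  obtain ⟨k, hk⟩ := hd
  have hk2 := congrArg (th b c) hk
  rw [map_mul (th b c) (ell b c), th_ell, zero_mul, map_add, map_mul, map_mul] at hk2
  obtain ⟨t, h1, h2⟩ := h.bin.syz hk2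
  have key : ∀ u, th b c u = 0 → ell b c ∣ u := fun u hu => by
    have := io_th b c u
    rwa [hu, map_zero, sub_zero] at this
  refine ⟨io t, key _ ?_, key _ ?_⟩
  · rw [map_sub, map_mul, th_io, h1]; ring
  · rw [map_add, map_mul, th_io, h2]; ring

lemma ell_ne (h : Su e F b c o) : ell b c ≠ 0 := by
  intro h0
  have := congrArg (eval (Pi.single 0 1)) h0
  rw [eval_ell] at this
  simp at this

lemma E5 (h : Su e F b c o) {u : S3} (hu : ell b c * u ∈ KK F o) : u ∈ KK F o := by
  obtain ⟨α, β, hab⟩ := mem_KK.1 hu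
  obtain ⟨t, ⟨α', h1⟩, ⟨β', h2⟩⟩ := h.P1 ⟨u, hab⟩
  refine mem_KK.2 ⟨α', β', ?_⟩
  apply mul_left_cancel₀ h.ell_ne
  linear_combination hab - F * h1 - dd o F * h2

lemma E6 (h : Su e F b c o) {u : S3} (m : ℕ) (hu : ell b c ^ m * u ∈ KK F o) : u ∈ KK F o := by
  induction m with
  | zero => simpa using hu
  | succ m ih =>
    apply ih; apply h.E5; convert hu using 1; ring

/-- (i) -/
lemma KK_of_II (h : Su e F b c o) {u : S3} {k : ℕ} (hu : u.IsHomogeneous k) (hI : u ∈ II F b c o) : u ∈ KK F o := by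
  obtain ⟨α, β, γ, hh⟩ := mem_II.1 hI
  have h0 : u - (γ * ell b c - γ) ∈ KK F o := mem_KK.2 ⟨α, β, by rw [hh]; ring⟩
  have hc := fun n => hcomp_KK h.hF h0 n
  simp only [map_sub] at hc
  have hcu : ∀ n, homogeneousComponent n u = if n = k then u else 0 := fun n =>
    homogeneousComponent_of_mem (n := k) hu
  have c0 : homogeneousComponent 0 (γ * ell b c) = 0 := hcomp_mul_lt (ell_hom b c) _ _ (by omega)
  have cs : ∀ n, homogeneousComponent (n + 1) (γ * ell b c) = homogeneousComponent n γ * ell b c :=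
    fun n => hcomp_mul (ell_hom b c) _ _
  have low : ∀ n, n < k → homogeneousComponent n γ ∈ KK F o := by
    intro n
    induction n with
    | zero =>
      intro hk
      have := hc 0
      rw [c0, hcu, if_neg (by omega)] at this
      simpa using this
    | succ n ih =>
      intro hk
      have := hc (n + 1)
      rw [cs, hcu, if_neg (by omega)] at this
      have h2 := Ideal.add_mem _ this (Ideal.mul_mem_right (ell b c) _ (ih (by omega)))
      convert h2 using 1; ring
  have atk : homogeneousComponent k γ + u ∈ KK F o := by
    have := hc k
    rw [hcu, if_pos rfl] at this
    rcases k with _ | k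
    · rw [c0] at this; convert this using 1; ring
    · rw [cs] at this
      have h2 := Ideal.add_mem _ this (Ideal.mul_mem_right (ell b c) _ (low k (by omega)))
      convert h2 using 1; ring
  have high : ∀ m, homogeneousComponent (k + m) γ + ell b c ^ m * u ∈ KK F o := by
    intro m
    induction m with
    | zero => simpa using atk
    | succ m ih =>
      have := hc (k + m + 1)
      rw [hcu, if_neg (by omega), cs] at this
      have h2 := Ideal.add_mem _ this (Ideal.mul_mem_right (ell b c) _ ih)
      convert h2 using 1; rw [← add_assoc k m 1]; ring
  have := high (γ.totalDegree + 1)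
  rw [homogeneousComponent_eq_zero _ _ (by omega), zero_add] at this
  exact h.E6 _ this

lemma zero_of_II (h : Su e F b c o) {u : S3} {k : ℕ} (hk : k < e + 3) (hu : u.IsHomogeneous k) (hI : u ∈ II F b c o) :
    u = 0 := by
  obtain ⟨α, β, hab⟩ := mem_KK.1 (h.KK_of_II hu hI)
  exact hom_zero_of_ideal h.hF h.hG hu hab.symm (by omega) hk

lemma E2 (h : Su e F b c o) {u : S3} (hu : u.IsHomogeneous (2 * e + 6)) : u ∈ JJ F b c o :=
  mem_JJ.2 (h.bin.top (th_hom _ _ hu))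

lemma E3 (h : Su e F b c o) : ∃ w : S3, w.IsHomogeneous (2 * e + 5) ∧ w ∉ JJ F b c o ∧
    ∀ u : S3, u.IsHomogeneous (2 * e + 5) → ∃ t : ℂ, u - C t * w ∈ JJ F b c o := by
  obtain ⟨w, h1, h2, h3⟩ := h.bin.codim
  refine ⟨io w, io_hom h1, ?_, ?_⟩
  · rw [mem_JJ, th_io]; exact h2
  · intro u hu
    obtain ⟨t, ht⟩ := h3 _ (th_hom b c hu)
    refine ⟨t, mem_JJ.2 ?_⟩
    rw [map_sub, map_mul, th_io]
    convert ht using 3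
    simp [th, algebraMap_eq]

lemma E4 (h : Su e F b c o) {u : S3} {k : ℕ} (hk : k ≤ 2 * e + 4) (hu : u.IsHomogeneous k)
    (hX : ∀ i, X i * u ∈ JJ F b c o) : u ∈ JJ F b c o := by
  refine mem_JJ.2 (h.bin.socle hk (th_hom _ _ hu) ?_ ?_)
  · have := mem_JJ.1 (hX 1)
    rw [map_mul] at this
    simpa [th] using this
  · have := mem_JJ.1 (hX 2)
    rw [map_mul] at this
    simpa [th] using this

/-- (d) -/
lemma down (h : Su e F b c o) {y : S3} {j : ℕ} (hy : y.IsHomogeneous (j + 1)) (hJ : y ∈ JJ F b c o) :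
    ∃ y', y'.IsHomogeneous j ∧ y - y' ∈ II F b c o := by
  obtain ⟨α, β, γ, hh⟩ := hJ
  refine ⟨homogeneousComponent j γ, homogeneousComponent_isHomogeneous _ _, ?_⟩
  have h0 : y - γ * ell b c ∈ KK F o := mem_KK.2 ⟨α, β, by rw [hh]; ring⟩
  have h1 := hcomp_KK h.hF h0 (j + 1)
  rw [map_sub, homogeneousComponent_of_mem (n := j + 1) hy, if_pos rfl, hcomp_mul (ell_hom b c)] at h1
  have h2 := Ideal.add_mem _ (KK_le_II (b := b) (c := c) h1)
    (Ideal.mul_mem_left _ (homogeneousComponent j γ) (ell_sub_mem (F := F) (b := b) (c := c) (o := o)))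
  convert h2 using 1; ring

lemma down0 (h : Su e F b c o) {y : S3} (hy : y.IsHomogeneous 0) (hJ : y ∈ JJ F b c o) : y = 0 := by
  obtain ⟨α, β, γ, hh⟩ := hJ
  have h1 : homogeneousComponent 0 y = 0 := by
    rw [hh, map_add, map_add, hcomp_mul_lt h.hF _ _ (by omega), hcomp_mul_lt h.hG _ _ (by omega),
      hcomp_mul_lt (ell_hom b c) _ _ (by omega)]
    simp
  rwa [homogeneousComponent_of_mem (n := 0) hy, if_pos rfl] at h1
end Su

namespace Su
variable {e : ℕ} {F : S3} {b c : ℂ} {o : V3}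

lemma toE (h : Su e F b c o) (u : S3) : ∃ u' : S3, u'.IsHomogeneous (2 * e + 5) ∧ u - u' ∈ II F b c o := by
  induction u using MvPolynomial.induction_on with
  | C a =>
    refine ⟨C a * ell b c ^ (2 * e + 5), ?_, ?_⟩
    · exact hom_cast ((isHomogeneous_C _ a).mul ((ell_hom b c).pow (2 * e + 5))) (by ring)
    · rw [← neg_mem_iff, neg_sub]; exact ell_pow_sub_mem _ _
  | add p q hp hq =>
    obtain ⟨p', hp, hp'⟩ := hp
    obtain ⟨q', hq, hq'⟩ := hq
    refine ⟨p' + q', hp.add hq, ?_⟩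
    convert add_mem hp' hq' using 1; ring
  | mul_X p n hp =>
    obtain ⟨p', hp, hp'⟩ := hp
    have hh : (p' * X n).IsHomogeneous (2 * e + 5 + 1) := hp.mul (isHomogeneous_X _ n)
    obtain ⟨y, hy, hy'⟩ := h.down hh (h.E2 hh)
    refine ⟨y, hy, ?_⟩
    convert add_mem (Ideal.mul_mem_right (X n) _ hp') hy' using 1; ring

lemma exists_rho (h : Su e F b c o) : ∃ ρ : S3 →ₗ[ℂ] ℂ, (∀ u ∈ II F b c o, ρ u = 0) ∧
    (∀ u : S3, u.IsHomogeneous (2 * e + 4) → ρ u = 0) ∧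
    ∀ u : S3, u.IsHomogeneous (2 * e + 5) → ρ u = 0 → u ∈ JJ F b c o := by
  obtain ⟨w, hw, hwJ, hw3⟩ := h.E3
  set N : Submodule ℂ S3 := (II F b c o).restrictScalars ℂ ⊔ homogeneousSubmodule (Fin 3) ℂ (2 * e + 4) with hN
  have hwN : w ∉ N := by
    intro hm
    obtain ⟨i, hi, u', hu', rfl⟩ := Submodule.mem_sup.1 hm
    have hu2 : u'.IsHomogeneous (2 * e + 4) := hu'
    have hi' : i ∈ II F b c o := hi
    have h1 : (i + u') - u' * ell b c ^ 1 ∈ II F b c o := by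
      have := sub_mem hi' (ell_pow_sub_mem (F := F) (o := o) (b := b) (c := c) 1 u')
      convert this using 1; ring
    have h2 : ((i + u') - u' * ell b c ^ 1).IsHomogeneous (2 * e + 5) :=
      hw.sub (hom_cast (hu2.mul ((ell_hom b c).pow 1)) (by ring))
    obtain ⟨α, β, hab⟩ := mem_KK.1 (h.KK_of_II h2 h1)
    exact hwJ ⟨α, β, u', by rw [hab]; ring⟩
  obtain ⟨ρ, hρ, hNρ⟩ := Submodule.exists_le_ker_of_notMem hwN
  have hI : ∀ u ∈ II F b c o, ρ u = 0 := fun u hu => hNρ (Submodule.mem_sup_left hu)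
  have hS : ∀ u : S3, u.IsHomogeneous (2 * e + 4) → ρ u = 0 := fun u hu =>
    hNρ (Submodule.mem_sup_right hu)
  refine ⟨ρ, hI, hS, ?_⟩
  intro u hu hu0
  obtain ⟨t, ht⟩ := hw3 u hu
  have hh : (u - C t * w).IsHomogeneous (2 * e + 4 + 1) :=
    hu.sub (hom_cast ((isHomogeneous_C _ t).mul hw) (by ring))
  obtain ⟨y, hy, hy'⟩ := h.down hh ht
  have h1 := hI _ hy'
  rw [map_sub, map_sub, hS y hy, hu0, ← smul_eq_C_mul, map_smul, smul_eq_mul] at h1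
  have : t = 0 := by
    have : t * ρ w = 0 := by linear_combination -h1
    exact (mul_eq_zero.1 this).resolve_right hρ
  subst this
  simpa using ht

lemma dual_c (h : Su e F b c o) {ρ : S3 →ₗ[ℂ] ℂ} (hρ : ∀ u : S3, u.IsHomogeneous (2 * e + 5) → ρ u = 0 → u ∈ JJ F b c o)
    (i : ℕ) : ∀ (j : ℕ) (y : S3), i + j = 2 * e + 5 → y.IsHomogeneous j →
    (∀ v : S3, v.IsHomogeneous i → ρ (y * v) = 0) → y ∈ JJ F b c o := by
  induction i with
  | zero =>
    intro j y hj hy hv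
    refine hρ y (hom_cast hy (by omega)) ?_
    simpa using hv 1 (isHomogeneous_one _ _)
  | succ i ih =>
    intro j y hj hy hv
    refine h.E4 (by omega) hy fun k => ?_
    refine ih (j + 1) _ (by omega) (hom_cast ((isHomogeneous_X _ k).mul hy) (by ring)) ?_
    intro v hvh
    have := hv (X k * v) (hom_cast ((isHomogeneous_X _ k).mul hvh) (by ring))
    rw [← this]; congr 1; ring

lemma dual_e (h : Su e F b c o) {ρ : S3 →ₗ[ℂ] ℂ} (hI : ∀ u ∈ II F b c o, ρ u = 0)
    (hρ : ∀ u : S3, u.IsHomogeneous (2 * e + 5) → ρ u = 0 → u ∈ JJ F b c o)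
    {y : S3} (hy : ∀ v, ρ (y * v) = 0) : y ∈ II F b c o := by
  have key : ∀ j : ℕ, j ≤ 2 * e + 5 → ∀ y : S3, y.IsHomogeneous j → (∀ v, ρ (y * v) = 0) →
      y ∈ II F b c o := by
    intro j
    induction j with
    | zero =>
      intro hj y hyh hy
      rw [h.down0 hyh (h.dual_c hρ (2 * e + 5) 0 y (by omega) hyh fun v _ => hy v)]
      exact zero_mem _
    | succ j ih =>
      intro hj y hyh hy
      obtain ⟨y', hy', hd⟩ := h.down hyh (h.dual_c hρ (2 * e + 5 - (j+1)) (j+1) y (by omega) hyh fun v _ => hy v)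
      have := ih (by omega) y' hy' fun v => by
        have := hI _ (Ideal.mul_mem_right v _ hd)
        rw [sub_mul, map_sub, hy v] at this
        linear_combination -this
      convert add_mem hd this using 1; ring
  obtain ⟨y', hy', hd⟩ := h.toE y
  have := key _ le_rfl y' hy' fun v => by
    have := hI _ (Ideal.mul_mem_right v _ hd)
    rw [sub_mul, map_sub, hy v] at this
    linear_combination -this
  convert add_mem hd this using 1; ring

lemma dual_f (h : Su e F b c o) {ρ : S3 →ₗ[ℂ] ℂ} (hI : ∀ u ∈ II F b c o, ρ u = 0)
    (hρ : ∀ u : S3, u.IsHomogeneous (2 * e + 5) → ρ u = 0 → u ∈ JJ F b c o)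
    (j : ℕ) : j ≤ 2 * e + 5 → ∀ y : S3, y.IsHomogeneous j →
    (∀ v : S3, v.IsHomogeneous (e + 4) → ρ (y * v) = 0) →
    ∃ y' : S3, y'.IsHomogeneous e ∧ y - y' ∈ II F b c o := by
  have low : ∀ j, j ≤ e → ∀ y : S3, y.IsHomogeneous j → ∃ y' : S3, y'.IsHomogeneous e ∧ y - y' ∈ II F b c o := by
    intro j hj y hy
    refine ⟨y * ell b c ^ (e - j), hom_cast (hy.mul ((ell_hom b c).pow (e - j))) (by omega), ?_⟩
    rw [← neg_mem_iff, neg_sub]; exact ell_pow_sub_mem _ _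
  induction j with
  | zero => intro hj y hyh hy; exact low 0 (by omega) y hyh
  | succ j ih =>
    intro hj y hyh hy
    by_cases hje : j + 1 ≤ e
    · exact low _ hje y hyh
    have hJ := h.dual_c hρ (2 * e + 5 - (j+1)) (j+1) y (by omega) hyh fun v hv => by
      have h1 := hy (v * ell b c ^ (e + 4 - (2 * e + 5 - (j+1))))
        (hom_cast (hv.mul ((ell_hom b c).pow _)) (by omega))
      have h2 := hI _ (ell_pow_sub_mem (F := F) (o := o) (b := b) (c := c) (e + 4 - (2 * e + 5 - (j+1))) (y * v))
      rw [map_sub, mul_assoc, h1] at h2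
      linear_combination -h2
    obtain ⟨y', hy', hd⟩ := h.down hyh hJ
    obtain ⟨y'', h1, h2⟩ := ih (by omega) y' hy' fun v hv => by
      have := hI _ (Ideal.mul_mem_right v _ hd)
      rw [sub_mul, map_sub, hy v hv] at this
      linear_combination -this
    refine ⟨y'', h1, ?_⟩
    convert add_mem hd h2 using 1; ring

lemma dual (h : Su e F b c o) {φ : S3 →ₗ[ℂ] ℂ} (hφI : ∀ u ∈ II F b c o, φ u = 0)
    (hφ4 : ∀ u : S3, u.IsHomogeneous (e + 4) → φ u = 0) :
    ∃ y : S3, y.IsHomogeneous e ∧ (∀ u, (∀ v, φ (u * v) = 0) → y * u ∈ II F b c o) ∧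
      (y = 0 → ∀ v, φ v = 0) := by
  obtain ⟨ρ, hI, -, hρ⟩ := h.exists_rho
  let W := homogeneousSubmodule (Fin 3) ℂ (2 * e + 5)
  let Ψ : W →ₗ[ℂ] Module.Dual ℂ W :=
    LinearMap.mk₂ ℂ (fun x y : W => ρ ((x : S3) * (y : S3)))
      (fun a b c => by simp [add_mul]) (fun t a b => by simp)
      (fun a b c => by simp [mul_add]) (fun t a b => by simp)
  have hmem : φ.domRestrict W ∈ (LinearMap.ker Ψ).dualAnnihilator := by
    rw [Submodule.mem_dualAnnihilator]
    intro x hx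
    have hx' : Ψ x = 0 := hx
    refine hφI _ (h.dual_e hI hρ fun v => ?_)
    obtain ⟨v', hv', hd⟩ := h.toE v
    have h1 : ρ ((x : S3) * v') = 0 := LinearMap.congr_fun hx' ⟨v', hv'⟩
    have := hI _ (Ideal.mul_mem_left _ (x : S3) hd)
    rw [mul_sub, map_sub, h1] at this
    change ρ ((x : S3) * v) = 0
    linear_combination this
  rw [← LinearMap.range_dualMap_eq_dualAnnihilator_ker] at hmem
  obtain ⟨Θ, hΘ⟩ := hmem
  obtain ⟨y, rfl⟩ := (Module.evalEquiv ℂ W).surjective Θ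
  have hy1 : ∀ v : S3, v.IsHomogeneous (2 * e + 5) → φ v = ρ (y * v) := fun v hv => by
    have := LinearMap.congr_fun hΘ ⟨v, hv⟩
    rw [mul_comm]
    exact this.symm
  have hy2 : ∀ v : S3, φ v = ρ (y * v) := fun v => by
    obtain ⟨v', hv', hd⟩ := h.toE v
    have h1 := hI _ (Ideal.mul_mem_left _ (y : S3) hd)
    have h2 := hφI _ hd
    rw [mul_sub, map_sub] at h1
    rw [map_sub] at h2
    linear_combination h2 - h1 + hy1 v' hv'
  obtain ⟨y', hy', hd⟩ := h.dual_f hI hρ (2 * e + 5) le_rfl y y.2 fun v hv => by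
    rw [← hy2, hφ4 v hv]
  have hy3 : ∀ v : S3, φ v = ρ (y' * v) := fun v => by
    have h1 := hI _ (Ideal.mul_mem_right v _ hd)
    rw [sub_mul, map_sub] at h1
    rw [hy2]; linear_combination h1
  refine ⟨y', hy', ?_, ?_⟩
  · intro u hu
    refine h.dual_e hI hρ fun v => ?_
    rw [mul_assoc, ← hy3, hu]
  · rintro rfl v
    rw [hy3]; simp
end Su


/-- dot product on `ℂ³` -/
def dt (v w : V3) : ℂ := v 0 * w 0 + v 1 * w 1 + v 2 * w 2

lemma dt_eq_sum (v w : V3) : dt v w = ∑ i, v i * w i := by simp [dt, Fin.sum_univ_three]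
lemma dt_comm (v w : V3) : dt v w = dt w v := by simp only [dt]; ring
lemma dt_add (v w x : V3) : dt v (w + x) = dt v w + dt v x := by
  simp only [dt, Pi.add_apply]; ring
lemma dt_smul (v w : V3) (t : ℂ) : dt v (t • w) = t * dt v w := by
  simp only [dt, Pi.smul_apply, smul_eq_mul]; ring

lemma lin3 {f a b w : V3} (hf : f ≠ 0) (ha : dt f a = 0) (hb : dt f b = 0) (hw : dt f w = 0) :
    ∃ α β γ : ℂ, ¬ (α = 0 ∧ β = 0 ∧ γ = 0) ∧ α • a + β • b + γ • w = 0 := by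
  have hdet : (Matrix.of ![a, b, w]).det = 0 := by
    rw [← Matrix.exists_mulVec_eq_zero_iff]
    refine ⟨f, hf, ?_⟩
    funext i
    fin_cases i <;> simp [Matrix.mulVec, dotProduct, Fin.sum_univ_three] <;>
      simp only [dt] at ha hb hw
    · linear_combination ha
    · linear_combination hb
    · linear_combination hw
  obtain ⟨v, hv, h0⟩ := Matrix.exists_vecMul_eq_zero_iff.2 hdet
  refine ⟨v 0, v 1, v 2, ?_, ?_⟩
  · rintro ⟨h1, h2, h3⟩
    apply hv
    funext i
    fin_cases i <;> assumption
  · funext i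
    have := congrFun h0 i
    simpa [Matrix.vecMul, dotProduct, Fin.sum_univ_three] using this

lemma ker2 (a b : V3) : ∃ τ : V3, τ ≠ 0 ∧ dt a τ = 0 ∧ dt b τ = 0 := by
  have hdet : (Matrix.of ![a, b, 0]).det = 0 := by
    apply Matrix.det_eq_zero_of_row_eq_zero 2
    intro j; simp
  obtain ⟨v, hv, h0⟩ := Matrix.exists_mulVec_eq_zero_iff.2 hdet
  refine ⟨v, hv, ?_, ?_⟩
  · have := congrFun h0 0
    simpa [Matrix.mulVec, dotProduct, Fin.sum_univ_three, dt] using this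
  · have := congrFun h0 1
    simpa [Matrix.mulVec, dotProduct, Fin.sum_univ_three, dt] using this

lemma span3 {f g k : V3} (hh : ∀ w, dt f w = 0 → dt g w = 0 → dt k w = 0 → w = 0) (v : V3) :
    ∃ α β γ : ℂ, v = α • f + β • g + γ • k := by
  have hdet : (Matrix.of ![f, g, k]).det ≠ 0 := by
    intro h0
    obtain ⟨v, hv, h0⟩ := Matrix.exists_mulVec_eq_zero_iff.2 h0
    refine hv (hh v ?_ ?_ ?_)
    · have := congrFun h0 0
      simpa [Matrix.mulVec, dotProduct, Fin.sum_univ_three, dt] using this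
    · have := congrFun h0 1
      simpa [Matrix.mulVec, dotProduct, Fin.sum_univ_three, dt] using this
    · have := congrFun h0 2
      simpa [Matrix.mulVec, dotProduct, Fin.sum_univ_three, dt] using this
  have hu : IsUnit (Matrix.of ![f, g, k]) := (Matrix.isUnit_iff_isUnit_det _).2 (isUnit_iff_ne_zero.2 hdet)
  obtain ⟨x, hx⟩ := Matrix.vecMul_surjective_iff_isUnit.2 hu v
  refine ⟨x 0, x 1, x 2, ?_⟩
  rw [← hx]
  funext i
  simp [Matrix.vecMul, dotProduct, Fin.sum_univ_three]

def mP (P : V3) : Ideal S3 := RingHom.ker (eval P)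
lemma mem_mP {P : V3} {u : S3} : u ∈ mP P ↔ eval P u = 0 := RingHom.mem_ker

def gr (f : S3) (P : V3) : V3 := fun i => eval P (pderiv i f)
def hs (f : S3) (P : V3) (i j : Fin 3) : ℂ := eval P (pderiv j (pderiv i f))

def xx (P : V3) (i : Fin 3) : S3 := X i - C (P i)
lemma xx_mem (P : V3) (i : Fin 3) : xx P i ∈ mP P := by simp [mem_mP, xx]

def LL (P v : V3) : S3 := C (v 0) * xx P 0 + C (v 1) * xx P 1 + C (v 2) * xx P 2
lemma LL_mem (P v : V3) : LL P v ∈ mP P :=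
  add_mem (add_mem (Ideal.mul_mem_left _ _ (xx_mem _ _)) (Ideal.mul_mem_left _ _ (xx_mem _ _)))
    (Ideal.mul_mem_left _ _ (xx_mem _ _))
lemma LL_add (P v w : V3) : LL P (v + w) = LL P v + LL P w := by simp [LL]; ring
lemma LL_smul (P v : V3) (t : ℂ) : LL P (t • v) = C t * LL P v := by simp [LL]; ring

def QQ (P : V3) (H : Fin 3 → Fin 3 → ℂ) : S3 := ∑ i, ∑ j, C (H i j) * (xx P i * xx P j)
lemma QQ_mem (P : V3) (H) : QQ P H ∈ mP P ^ 2 := by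
  refine sum_mem fun i _ => sum_mem fun j _ => Ideal.mul_mem_left _ _ ?_
  rw [pow_two]; exact Ideal.mul_mem_mul (xx_mem _ _) (xx_mem _ _)

lemma gr_mul_X (f : S3) (n : Fin 3) (P : V3) :
    gr (f * X n) P = P n • gr f P + eval P f • Pi.single n 1 := by
  funext i
  simp [gr, pderiv_mul, pderiv_X, Pi.single_apply]
  by_cases hin : i = n
  · simp [hin]; ring
  · simp [hin, Ne.symm hin]

lemma taylor1 (P : V3) (f : S3) : f - C (eval P f) - LL P (gr f P) ∈ mP P ^ 2 := by
  induction f using MvPolynomial.induction_on with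
  | C a =>
    have : gr (C a) P = 0 := by funext i; simp [gr]
    rw [this]; simp [LL]
  | add p q hp hq =>
    have : gr (p + q) P = gr p P + gr q P := by funext i; simp [gr]
    rw [this, LL_add]
    convert add_mem hp hq using 1
    simp; ring
  | mul_X f n hp =>
    rw [gr_mul_X, LL_add, LL_smul, LL_smul]
    have h1 : LL P (Pi.single n 1) = xx P n := by
      fin_cases n <;> simp [LL]
    have h2 : LL P (gr f P) * xx P n ∈ mP P ^ 2 := by
      rw [pow_two]; exact Ideal.mul_mem_mul (LL_mem _ _) (xx_mem _ _)
    convert add_mem (Ideal.mul_mem_right (X n) _ hp) h2 using 1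
    rw [h1, xx]; simp; ring

lemma taylor2 (P : V3) (f : S3) :
    2 * f - 2 * C (eval P f) - 2 * LL P (gr f P) - QQ P (hs f P) ∈ mP P ^ 3 := by
  induction f using MvPolynomial.induction_on with
  | C a =>
    have : gr (C a) P = 0 := by funext i; simp [gr]
    have h2 : hs (C a) P = 0 := by funext i j; simp [hs]
    rw [this, h2]; simp [LL, QQ]
  | add p q hp hq =>
    have : gr (p + q) P = gr p P + gr q P := by funext i; simp [gr]
    have h2 : QQ P (hs (p + q) P) = QQ P (hs p P) + QQ P (hs q P) := by
      simp [QQ, hs, add_mul, Finset.sum_add_distrib]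
    rw [this, LL_add, h2]
    convert add_mem hp hq using 1
    simp; ring
  | mul_X f n hp =>
    rw [gr_mul_X, LL_add, LL_smul, LL_smul]
    have h1 : LL P (Pi.single n 1) = xx P n := by
      fin_cases n <;> simp [LL]
    have h2 : QQ P (hs f P) * xx P n ∈ mP P ^ 3 := by
      rw [pow_succ]; exact Ideal.mul_mem_mul (QQ_mem _ _) (xx_mem _ _)
    have h3 : QQ P (hs (f * X n) P) = C (P n) * QQ P (hs f P) + 2 * (LL P (gr f P) * xx P n) := by
      simp only [QQ, hs, Fin.sum_univ_three, LL, gr, pderiv_mul, map_add, pderiv_X]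
      fin_cases n <;> simp [Pi.single_apply] <;> ring
    convert add_mem (Ideal.mul_mem_right (X n) _ hp) h2 using 1
    rw [h1, h3, xx]; simp; ring

lemma mP_le {P : V3} {J : Ideal S3} (hJ : ∀ v, LL P v ∈ J ⊔ mP P ^ 2) : mP P ≤ J ⊔ mP P ^ 2 := by
  intro u hu
  have h1 := taylor1 P u
  rw [mem_mP.1 hu] at h1
  have := add_mem (Submodule.mem_sup_right (S := J) h1) (hJ (gr u P))
  simpa using this



namespace Su
variable {e : ℕ} {F : S3} {b c : ℂ} {o : V3}

/-- gradient of ell -/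
def gl (b c : ℂ) : V3 := ![1, b, c]

lemma dt_gl (v : V3) : dt (gl b c) v = v 0 + b * v 1 + c * v 2 := by simp [dt, gl]
lemma dt_gl' (v : V3) : dt (gl b c) v = eval v (ell b c) := by rw [dt_gl, eval_ell]

lemma gr_ell (P : V3) : gr (ell b c - 1) P = gl b c := by
  funext i
  fin_cases i <;> simp [gr, ell, gl, pderiv_X]

/-- the affine points -/
def Gam (F : S3) (b c : ℂ) (o : V3) : Set V3 :=
  {P | eval P (ell b c) = 1 ∧ eval P F = 0 ∧ eval P (dd o F) = 0}

lemma Gam_ne {P : V3} (hP : P ∈ Gam F b c o) : P ≠ 0 := by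
  rintro rfl
  have := hP.1
  rw [eval_ell] at this
  simp at this

lemma II_le_mP {P : V3} (hP : P ∈ Gam F b c o) : II F b c o ≤ mP P := by
  intro u hu
  obtain ⟨α, β, γ, rfl⟩ := mem_II.1 hu
  rw [mem_mP]; simp [hP.1, hP.2.1, hP.2.2]

lemma Gam_of_II {P : V3} (hP : II F b c o ≤ mP P) : P ∈ Gam F b c o := by
  refine ⟨?_, ?_, ?_⟩
  · have := mem_mP.1 (hP (ell_sub_mem))
    simpa [sub_eq_zero] using this
  · exact mem_mP.1 (hP (mem_II.2 ⟨1, 0, 0, by ring⟩))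
  · exact mem_mP.1 (hP (mem_II.2 ⟨0, 1, 0, by ring⟩))

/-- `o` and `P` are independent -/
lemma o_ne (h : Su e F b c o) {P : V3} (hP : eval P F = 0) {α β : ℂ} (h0 : α • o + β • P = 0) : α = 0 := by
  by_contra ha
  have : o = (-(β / α)) • P := by
    have h1 : α • o = -(β • P) := eq_neg_of_add_eq_zero_left h0
    have h2 : o = α⁻¹ • (α • o) := by rw [smul_smul, inv_mul_cancel₀ ha, one_smul]
    rw [h2, h1, smul_neg, smul_smul, neg_smul]; congr 2; field_simp
  apply h.o1
  rw [this, hom_eval_smul h.hF, hP, mul_zero]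

lemma dt_gr_o (P : V3) (f : S3) : dt (gr f P) o = eval P (dd o f) := by
  rw [dt_comm, dt_eq_sum, eval_dd]; rfl

lemma dt_gr_P {f : S3} {n : ℕ} (hf : f.IsHomogeneous n) (P : V3) : dt (gr f P) P = n * eval P f := by
  rw [dt_comm, dt_eq_sum, ← euler_eval hf]; rfl

lemma smooth_span (h : Su e F b c o) {P : V3} (hP : P ∈ Gam F b c o) (hs : ¬ Sg F P) (w : V3)
    (h1 : dt (gr F P) w = 0) (h2 : dt (gr (dd o F) P) w = 0) (h3 : dt (gl b c) w = 0) : w = 0 := by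
  have hg : gr F P ≠ 0 := fun h0 => hs fun i => congrFun h0 i
  obtain ⟨α, β, γ, hne, h0⟩ := lin3 (a := o) (b := P) (w := w) hg
    (by rw [dt_gr_o, hP.2.2]) (by rw [dt_gr_P h.hF, hP.2.1, mul_zero]) h1
  have hα : α = 0 := by
    have := congrArg (dt (gr (dd o F) P)) h0
    rw [dt_add, dt_add, dt_smul, dt_smul, dt_smul, h2, dt_gr_o, dt_gr_P h.hG, hP.2.2] at this
    have h4 := h.o2 P (Gam_ne hP) hP.2.1 hP.2.2
    have h5 : α * eval P (dd o (dd o F)) = 0 := by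
      rw [show dt (gr (dd o F) P) 0 = 0 by simp [dt]] at this
      linear_combination this
    exact (mul_eq_zero.1 h5).resolve_right h4
  have hβ : β = 0 := by
    have := congrArg (dt (gl b c)) h0
    rw [dt_add, dt_add, dt_smul, dt_smul, dt_smul, h3, hα, dt_gl' P, hP.1,
      show dt (gl b c) 0 = 0 by simp [dt]] at this
    linear_combination this
  have hγ : γ ≠ 0 := fun hγ => hne ⟨hα, hβ, hγ⟩
  rw [hα, hβ] at h0
  simpa [hγ] using h0

lemma LL_gr_mem {P : V3} {f : S3} (hf : f ∈ II F b c o) (hP : P ∈ Gam F b c o) :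
    LL P (gr f P) ∈ II F b c o ⊔ mP P ^ 2 := by
  have h1 := taylor1 P f
  rw [mem_mP.1 (II_le_mP hP hf)] at h1
  have := sub_mem (Submodule.mem_sup_left (T := mP P ^ 2) hf) (Submodule.mem_sup_right (S := II F b c o) h1)
  simpa using this

lemma F_mem : F ∈ II F b c o := mem_II.2 ⟨1, 0, 0, by ring⟩
lemma G_mem : dd o F ∈ II F b c o := mem_II.2 ⟨0, 1, 0, by ring⟩

lemma local_smooth (h : Su e F b c o) {P : V3} (hP : P ∈ Gam F b c o) (hs : ¬ Sg F P) :
    ∃ r : S3, eval P r = 1 ∧ ∀ u ∈ mP P, r * u ∈ II F b c o := by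
  have key : mP P ≤ II F b c o ⊔ mP P ^ 2 := by
    apply mP_le
    intro v
    obtain ⟨α, β, γ, rfl⟩ := span3 (h.smooth_span hP hs) v
    rw [LL_add, LL_add, LL_smul, LL_smul, LL_smul]
    refine add_mem (add_mem ?_ ?_) ?_
    · exact Ideal.mul_mem_left _ _ (LL_gr_mem F_mem hP)
    · exact Ideal.mul_mem_left _ _ (LL_gr_mem G_mem hP)
    · rw [← gr_ell P]; exact Ideal.mul_mem_left _ _ (LL_gr_mem ell_sub_mem hP)
  rw [pow_two] at key
  obtain ⟨r, hr, hr2⟩ := Submodule.exists_sub_one_mem_and_smul_le_of_fg_of_le_sup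
    (I := mP P) (N := II F b c o) (N' := mP P) (P := mP P) (IsNoetherian.noetherian _) le_rfl key
  refine ⟨r, ?_, ?_⟩
  · have := mem_mP.1 hr
    simpa [sub_eq_zero] using this
  · intro u hu
    exact hr2 (Submodule.smul_mem_pointwise_smul u r _ hu)

lemma hs_o {P : V3} (i : Fin 3) : gr (dd o F) P i = ∑ j, o j * hs F P i j := by
  simp only [gr, hs]
  rw [← dd_pd, eval_dd]

lemma hs_symm (f : S3) (P : V3) (i j : Fin 3) : hs f P i j = hs f P j i := by
  simp only [hs, pd_comm i j]

/-- Hessian times vector -/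
def hv (F : S3) (P v : V3) : V3 := fun i => ∑ j, v j * hs F P i j

lemma gr_G (P : V3) : gr (dd o F) P = hv F P o := by
  funext i
  rw [hs_o i]
  rfl

lemma hv_symm (P v w : V3) : dt (hv F P v) w = dt (hv F P w) v := by
  simp only [dt, hv, Fin.sum_univ_three]
  rw [hs_symm F P 1 0, hs_symm F P 2 0, hs_symm F P 2 1]
  ring

lemma hv_P (h : Su e F b c o) {P : V3} (hs : Sg F P) : hv F P P = 0 := by
  funext i
  have := euler_eval (h.hF.pderiv (i := i)) P
  rw [hs i, mul_zero] at this
  exact this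

lemma hv_ne (h : Su e F b c o) {P v : V3} (hP : P ≠ 0) (hs : Sg F P) (hv0 : hv F P v = 0) : ∃ t : ℂ, v = t • P :=
  h.nod P hP hs v fun i => congrFun hv0 i

lemma o_ne' (h : Su e F b c o) {P : V3} (hP : eval P F = 0) : ¬ ∃ t : ℂ, o = t • P := by
  rintro ⟨t, ht⟩
  apply h.o1
  rw [ht, hom_eval_smul h.hF, hP, mul_zero]

lemma gr_G_ne (h : Su e F b c o) {P : V3} (hP : P ∈ Gam F b c o) (hs : Sg F P) : gr (dd o F) P ≠ 0 := by
  rw [gr_G]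
  exact fun h0 => h.o_ne' hP.2.1 (h.hv_ne (Gam_ne hP) hs h0)

/-- a vector in the kernel of `∇G` and `ℓ` is not isotropic -/
lemma noniso (h : Su e F b c o) {P τ : V3} (hP : P ∈ Gam F b c o) (hs : Sg F P) (hτ : τ ≠ 0)
    (h1 : dt (gl b c) τ = 0) (h2 : dt (gr (dd o F) P) τ = 0) : dt (hv F P τ) τ ≠ 0 := by
  intro h0
  have hoo := h.o2 P (Gam_ne hP) hP.2.1 hP.2.2
  rw [← dt_gr_o] at hoo
  have hn : hv F P τ ≠ 0 := by
    intro hh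
    obtain ⟨t, rfl⟩ := h.hv_ne (Gam_ne hP) hs hh
    rw [dt_smul, dt_gl' P, hP.1, mul_one] at h1
    exact hτ (by rw [h1, zero_smul])
  obtain ⟨α, β, γ, hne, hz⟩ := lin3 (a := o) (b := P) (w := τ) hn
    (by rw [hv_symm, ← gr_G, h2]) (by rw [hv_symm, h.hv_P hs]; simp [dt]) h0
  have hα : α = 0 := by
    have := congrArg (dt (gr (dd o F) P)) hz
    rw [dt_add, dt_add, dt_smul, dt_smul, dt_smul, h2, dt_gr_P h.hG, hP.2.2,
      show dt (gr (dd o F) P) 0 = 0 by simp [dt]] at this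
    have h5 : α * dt (gr (dd o F) P) o = 0 := by linear_combination this
    exact (mul_eq_zero.1 h5).resolve_right hoo
  have hβ : β = 0 := by
    have := congrArg (dt (gl b c)) hz
    rw [dt_add, dt_add, dt_smul, dt_smul, dt_smul, h1, hα, dt_gl' P, hP.1,
      show dt (gl b c) 0 = 0 by simp [dt]] at this
    linear_combination this
  have hγ : γ ≠ 0 := fun hγ => hne ⟨hα, hβ, hγ⟩
  rw [hα, hβ] at hz
  exact hτ (by simpa [hγ] using hz)

lemma local_node (h : Su e F b c o) {P : V3} (hP : P ∈ Gam F b c o) (hs : Sg F P) :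
    ∃ r : S3, eval P r = 1 ∧ ∀ u ∈ mP P ^ 2, r * u ∈ II F b c o := by
  obtain ⟨τ, hτ, h1, h2⟩ := ker2 (gl b c) (gr (dd o F) P)
  have hiso := h.noniso hP hs hτ h1 h2
  obtain ⟨μ, hμ⟩ : ∃ μ : V3, dt μ τ = 1 := by
    refine ⟨(dt (hv F P τ) τ)⁻¹ • hv F P τ, ?_⟩
    rw [dt_comm, dt_smul, dt_comm τ, inv_mul_cancel₀ hiso]
  set K := II F b c o ⊔ mP P ^ 2 with hK
  set N := II F b c o ⊔ mP P ^ 3 with hN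
  have hKN : ∀ u ∈ K, ∀ v ∈ mP P, u * v ∈ N := by
    intro u hu v hv
    obtain ⟨i, hi, q, hq, rfl⟩ := Submodule.mem_sup.1 hu
    rw [add_mul]
    refine add_mem (Submodule.mem_sup_left (Ideal.mul_mem_right _ _ hi)) (Submodule.mem_sup_right ?_)
    rw [pow_succ]; exact Ideal.mul_mem_mul hq hv
  have hl : LL P (gl b c) ∈ K := by rw [← gr_ell P]; exact LL_gr_mem ell_sub_mem hP
  have hg : LL P (gr (dd o F) P) ∈ K := LL_gr_mem G_mem hP
  have red : ∀ v, LL P v - C (dt v τ) * LL P μ ∈ K := by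
    intro v
    set w : V3 := v + (-(dt v τ)) • μ with hw
    have hwτ : dt τ w = 0 := by rw [hw, dt_add, dt_smul, dt_comm τ μ, hμ, dt_comm]; ring
    obtain ⟨α, β, γ, hne, hz⟩ := lin3 (a := gl b c) (b := gr (dd o F) P) (w := w) hτ
      (by rw [dt_comm, h1]) (by rw [dt_comm, h2]) hwτ
    have hγ : γ ≠ 0 := by
      intro hγ
      rw [hγ, zero_smul, add_zero] at hz
      have hα : α = 0 := by
        have := congrArg (dt P) hz
        rw [dt_add, dt_smul, dt_smul, dt_comm P, dt_comm P, dt_gl' P, hP.1, dt_gr_P h.hG, hP.2.2,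
          show dt P 0 = 0 by simp [dt]] at this
        linear_combination this
      rw [hα, zero_smul, zero_add] at hz
      exact hne ⟨hα, (smul_eq_zero.1 hz).resolve_right (h.gr_G_ne hP hs), hγ⟩
    have h3 : LL P (γ • w) ∈ K := by
      have : γ • w = (-α) • gl b c + (-β) • gr (dd o F) P := by
        rw [← sub_eq_zero, ← hz, neg_smul, neg_smul]; abel
      rw [this, LL_add, LL_smul, LL_smul]
      exact add_mem (Ideal.mul_mem_left _ _ hl) (Ideal.mul_mem_left _ _ hg)
    have h4 : LL P w ∈ K := by
      have := Ideal.mul_mem_left K (C γ⁻¹) h3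
      rwa [← LL_smul, smul_smul, inv_mul_cancel₀ hγ, one_smul] at this
    rw [hw, LL_add, LL_smul] at h4
    convert h4 using 1; simp; ring
  have red2 : ∀ v w, LL P v * LL P w - C (dt v τ * dt w τ) * LL P μ ^ 2 ∈ N := by
    intro v w
    have e1 := hKN _ (red v) _ (LL_mem P w)
    have e2 := Ideal.mul_mem_left N (C (dt v τ)) (hKN _ (red w) _ (LL_mem P μ))
    convert add_mem e1 e2 using 1
    simp; ring
  have hx : ∀ i, xx P i = LL P (Pi.single i 1) := by
    intro i; fin_cases i <;> simp [LL]
  have hdx : ∀ i : Fin 3, dt (Pi.single i 1) τ = τ i := by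
    intro i; fin_cases i <;> simp [dt]
  have hQ : QQ P (_root_.hs F P) ∈ N := by
    have := taylor2 P F
    have h0 : gr F P = 0 := funext hs
    rw [hP.2.1, h0] at this
    have h5 : 2 * F ∈ N := Submodule.mem_sup_left (Ideal.mul_mem_left _ _ F_mem)
    have h6 := sub_mem h5 (Submodule.mem_sup_right (S := II F b c o) this)
    simpa [LL] using h6
  have hμ2 : LL P μ ^ 2 ∈ N := by
    have h7 : QQ P (_root_.hs F P) - C (dt (hv F P τ) τ) * LL P μ ^ 2 ∈ N := by
      have : QQ P (_root_.hs F P) - C (dt (hv F P τ) τ) * LL P μ ^ 2 =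
        ∑ i, ∑ j, C (_root_.hs F P i j) * (xx P i * xx P j - C (τ i * τ j) * LL P μ ^ 2) := by
        simp only [QQ, Fin.sum_univ_three, dt, hv, _root_.hs, map_add, map_mul]; ring
      rw [this]
      refine sum_mem fun i _ => sum_mem fun j _ => Ideal.mul_mem_left _ _ ?_
      rw [hx, hx, ← hdx i, ← hdx j]
      exact red2 _ _
    have h8 := sub_mem hQ h7
    rw [sub_sub_cancel] at h8
    have := Ideal.mul_mem_left N (C (dt (hv F P τ) τ)⁻¹) h8
    rwa [← mul_assoc, ← C_mul, inv_mul_cancel₀ hiso, C_1, one_mul] at this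
  have key : mP P ^ 2 ≤ N := by
    rw [pow_two, Ideal.mul_le]
    intro u hu v hv
    have t1 := taylor1 P u
    have t2 := taylor1 P v
    rw [mem_mP.1 hu] at t1
    rw [mem_mP.1 hv] at t2
    have e1 : (u - C 0 - LL P (gr u P)) * v ∈ N :=
      hKN _ (Submodule.mem_sup_right t1) _ hv
    have e2 : (v - C 0 - LL P (gr v P)) * LL P (gr u P) ∈ N :=
      hKN _ (Submodule.mem_sup_right t2) _ (LL_mem _ _)
    have e3 := add_mem (red2 (gr u P) (gr v P)) (Ideal.mul_mem_left N (C (dt (gr u P) τ * dt (gr v P) τ)) hμ2)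
    convert add_mem (add_mem e1 e2) e3 using 1
    simp; ring
  have key : mP P ^ 2 ≤ II F b c o ⊔ mP P • mP P ^ 2 := by
    rw [smul_eq_mul, ← pow_succ']; exact key
  obtain ⟨r, hr, hr2⟩ := Submodule.exists_sub_one_mem_and_smul_le_of_fg_of_le_sup
    (I := mP P) (N := II F b c o) (N' := mP P ^ 2) (P := mP P ^ 2) (IsNoetherian.noetherian _) le_rfl key
  refine ⟨r, ?_, ?_⟩
  · have := mem_mP.1 hr
    simpa [sub_eq_zero] using this
  · intro u hu
    exact hr2 (Submodule.smul_mem_pointwise_smul u r _ hu)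

lemma F3 (h : Su e F b c o) {u1 u2 : S3} (hD : ∀ P ∈ Gam F b c o, Sg F P → eval P u1 = 0 ∧ eval P u2 = 0)
    (hR : ∀ P ∈ Gam F b c o, eval P (u1 * u2) = 0) : u1 * u2 ∈ II F b c o := by
  by_contra hu
  let A : Ideal S3 := (II F b c o).colon {u1 * u2}
  have hA : ∀ r, r ∈ A ↔ r * (u1 * u2) ∈ II F b c o := fun r => by
    simp [A, Submodule.mem_colon_singleton]
  have hne : A ≠ ⊤ := by
    intro ht
    apply hu
    have : (1 : S3) ∈ A := by rw [ht]; trivial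
    simpa using (hA 1).1 this
  obtain ⟨M, hM, hAM⟩ := Ideal.exists_le_maximal A hne
  obtain ⟨P, rfl⟩ := isMaximal_iff_eq_vanishingIdeal_singleton.1 hM
  have hm : ∀ u, u ∈ vanishingIdeal ℂ {P} → eval P u = 0 := fun u hu => by
    simpa [aeval_eq_eval] using (mem_vanishingIdeal_singleton_iff P u).1 hu
  have hP : P ∈ Gam F b c o := Gam_of_II fun u hu => by
    refine mem_mP.2 (hm u (hAM ((hA u).2 (Ideal.mul_mem_right _ _ hu))))
  by_cases hs : Sg F P
  · obtain ⟨r, hr, hr2⟩ := h.local_node hP hs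
    have : r * (u1 * u2) ∈ II F b c o := by
      apply hr2
      rw [pow_two]
      exact Ideal.mul_mem_mul (mem_mP.2 (hD P hP hs).1) (mem_mP.2 (hD P hP hs).2)
    have := hm r (hAM ((hA r).2 this))
    rw [hr] at this; exact one_ne_zero this
  · obtain ⟨r, hr, hr2⟩ := h.local_smooth hP hs
    have := hm r (hAM ((hA r).2 (hr2 _ (mem_mP.2 (hR P hP)))))
    rw [hr] at this; exact one_ne_zero this
end Su


lemma eval_linF' (v p : V3) : eval p (linF v) = dt v p := by rw [eval_linF, dt_eq_sum]

lemma linF_irr {v : V3} (hv : v ≠ 0) : Irreducible (linF v) := by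
  apply irreducible_of_totalDegree_eq_one
  · exact (linF_hom v).totalDegree (linF_ne hv)
  · intro x hx
    obtain ⟨i, hi⟩ := ne_zero_iff.1 (linF_ne hv)
    rw [isUnit_iff_ne_zero]
    rintro rfl
    exact hi (zero_dvd_iff.1 (hx i))

lemma gr_mul (f g : S3) (P : V3) : gr (f * g) P = eval P f • gr g P + eval P g • gr f P := by
  funext i
  simp [gr]

lemma gr_add (f g : S3) (P : V3) : gr (f + g) P = gr f P + gr g P := by
  funext i
  simp [gr]

lemma gr_Sg {F : S3} {P : V3} (hs : Sg F P) : gr F P = 0 := funext hs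

lemma sep (T : Finset V3) (p : V3) (hp : p ∉ T) : ∃ u : S3, eval p u = 1 ∧ ∀ q ∈ T, eval q u = 0 := by
  classical
  induction T using Finset.induction_on with
  | empty => exact ⟨1, by simp, by simp⟩
  | insert q T hq ih =>
    obtain ⟨u, hu, hu2⟩ := ih fun h => hp (Finset.mem_insert_of_mem h)
    have hne : p ≠ q := fun h => hp (by rw [h]; exact Finset.mem_insert_self _ _)
    obtain ⟨i, hi⟩ := Function.ne_iff.1 hne
    have hi' : p i - q i ≠ 0 := sub_ne_zero.2 hi
    refine ⟨u * (C (p i - q i)⁻¹ * (X i - C (q i))), ?_, ?_⟩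
    · simp only [map_mul, hu, eval_C, map_sub, eval_X]
      rw [inv_mul_cancel₀ hi', one_mul]
    · intro r hr
      rcases Finset.mem_insert.1 hr with rfl | hr
      · simp
      · simp [hu2 r hr]

lemma choose_sep (V : Submodule ℂ S3) (R : Finset V3)
    (hR : ∀ h ∈ V, (∀ P ∈ R, eval P h = 0) → h = 0) :
    ∃ R' ⊆ R, (∀ h ∈ V, (∀ P ∈ R', eval P h = 0) → h = 0) ∧
      ∀ p ∈ R', ∃ h ∈ V, eval p h ≠ 0 ∧ ∀ q ∈ R', q ≠ p → eval q h = 0 := by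
  classical
  induction R using Finset.strongInduction with
  | H R ih =>
    by_cases hex : ∃ p ∈ R, ∀ h ∈ V, (∀ P ∈ R.erase p, eval P h = 0) → h = 0
    · obtain ⟨p, hp, hh⟩ := hex
      obtain ⟨R', h1, h2⟩ := ih _ (Finset.erase_ssubset hp) hh
      exact ⟨R', h1.trans (Finset.erase_subset _ _), h2⟩
    · push Not at hex
      refine ⟨R, subset_rfl, hR, fun p hp => ?_⟩
      obtain ⟨h, hV, h1, h2⟩ := hex p hp
      refine ⟨h, hV, fun h0 => h2 (hR h hV fun P hP => ?_), fun q hq hqp => h1 q (Finset.mem_erase.2 ⟨hqp, hq⟩)⟩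
      by_cases hPp : P = p
      · rw [hPp, h0]
      · exact h1 P (Finset.mem_erase.2 ⟨hPp, hP⟩)

lemma combine (W : Submodule ℂ S3) (T : Finset V3) (hT : ∀ p ∈ T, ∃ s ∈ W, eval p s ≠ 0) :
    ∃ s ∈ W, ∀ p ∈ T, eval p s ≠ 0 := by
  classical
  induction T using Finset.induction_on with
  | empty => exact ⟨0, zero_mem _, by simp⟩
  | insert p T hp ih =>
    obtain ⟨s, hs, hs2⟩ := ih fun q hq => hT q (Finset.mem_insert_of_mem hq)
    obtain ⟨r, hr, hr2⟩ := hT p (Finset.mem_insert_self _ _)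
    obtain ⟨t, ht⟩ := Infinite.exists_notMem_finset
      ((insert p T).image fun q => -(eval q s) / eval q r)
    refine ⟨s + t • r, add_mem hs (W.smul_mem _ hr), fun q hq h0 => ?_⟩
    rw [map_add, smul_eval] at h0
    by_cases hq0 : eval q r = 0
    · rcases Finset.mem_insert.1 hq with rfl | hq'
      · exact hr2 hq0
      · rw [hq0, mul_zero, add_zero] at h0
        exact hs2 q hq' h0
    · apply ht
      refine Finset.mem_image.2 ⟨q, hq, ?_⟩
      field_simp
      linear_combination -h0

namespace Su
variable {e : ℕ} {F : S3} {b c : ℂ} {o : V3}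

lemma G_ne (h : Su e F b c o) : dd o F ≠ 0 := by
  intro h0
  have h1 := dt_gr_P h.hF o
  rw [dt_gr_o, h0, map_zero] at h1
  have h2 : ((e + 4 : ℕ) : ℂ) ≠ 0 := by exact_mod_cast (by omega : e + 4 ≠ 0)
  exact mul_ne_zero h2 h.o1 h1.symm

lemma F_not_dvd_G (h : Su e F b c o) : ¬ F ∣ dd o F := h.not_dvd_lt h.hG (by omega) h.G_ne

lemma Gam_fin (h : Su e F b c o) : (Gam F b c o).Finite := by
  classical
  obtain ⟨B, -, hB⟩ := finite_common_zeros h.hirr h.hF h.hG h.F_not_dvd_G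
  refine (B.image fun p => (eval p (ell b c))⁻¹ • p).finite_toSet.subset ?_
  intro P hP
  obtain ⟨q, hq, t, ht, rfl⟩ := hB P (Gam_ne hP) hP.2.1 hP.2.2
  simp only [Finset.coe_image, Set.mem_image]
  refine ⟨q, hq, ?_⟩
  have h1 := hP.1
  rw [hom_eval_smul (ell_hom b c), pow_one] at h1
  congr 1
  exact (eq_inv_of_mul_eq_one_left h1).symm

lemma mul_step (h : Su e F b c o) {k v : S3} {n : ℕ} (hk : k.IsHomogeneous (e + 1)) (hk0 : ∀ P ∈ Gam F b c o, eval P k = 0)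
    (hv : v.IsHomogeneous n) (hv0 : ∀ P ∈ Gam F b c o, Sg F P → eval P v = 0) :
    ∃ m : ℕ, F ∣ k ^ m * v := by
  induction n using Nat.strong_induction_on generalizing v with
  | _ n ih =>
    have h1 : k * v ∈ II F b c o := h.F3 (fun P hP hs => ⟨hk0 P hP, hv0 P hP hs⟩)
      fun P hP => by rw [map_mul, hk0 P hP, zero_mul]
    obtain ⟨α, β, hab⟩ := mem_KK.1 (h.KK_of_II (hk.mul hv) h1)
    obtain ⟨α, β, hab, -, hβ, -, hβ0⟩ := hom_rep2 h.hF h.hG (hk.mul hv) hab.symm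
    by_cases hn : n < 2
    · refine ⟨1, α, ?_⟩
      rw [pow_one, hab, hβ0 (by omega)]; ring
    · obtain ⟨m, hm⟩ := ih (e + 1 + n - (e + 3)) (by omega) hβ (by
        intro P hP hs
        have h2 := congrArg (fun f => gr f P) hab
        simp only [gr_mul, gr_add, hk0 P hP, hv0 P hP hs, gr_Sg hs, hP.2.1, hP.2.2] at h2
        simp only [zero_smul, smul_zero, add_zero, zero_add] at h2
        exact (smul_eq_zero.1 h2.symm).resolve_right (h.gr_G_ne hP hs))
      refine ⟨m + 1, ?_⟩
      have : k ^ (m + 1) * v = k ^ m * α * F + k ^ m * β * dd o F := by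
        rw [pow_succ, mul_assoc, hab]; ring
      rw [this]
      exact dvd_add (Dvd.intro_left _ rfl) (Dvd.dvd.mul_right hm _)

lemma inj (h : Su e F b c o) {k : S3} (hk : k.IsHomogeneous (e + 1)) (hk0 : ∀ P ∈ Gam F b c o, eval P k = 0) : k = 0 := by
  obtain ⟨m, hm⟩ := h.mul_step hk hk0 hk fun P hP _ => hk0 P hP
  have hp : Prime F := h.hirr.prime
  rw [← pow_succ] at hm
  by_contra h0
  exact h.not_dvd_lt hk (by omega) h0 (hp.dvd_of_dvd_pow hm)

/-- point derivation at nodes kills II -/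
lemma node_deriv (h : Su e F b c o) {P τ : V3} (hP : P ∈ Gam F b c o) (hs : Sg F P)
    (h1 : dt (gl b c) τ = 0) (h2 : dt (gr (dd o F) P) τ = 0) {u : S3} (hu : u ∈ II F b c o) :
    dt τ (gr u P) = 0 := by
  obtain ⟨α, β, γ, rfl⟩ := mem_II.1 hu
  have hl : eval P (ell b c - 1) = 0 := by simp [hP.1]
  rw [gr_add, gr_add, gr_mul, gr_mul, gr_mul, gr_Sg hs, gr_ell, hP.2.1, hP.2.2, hl]
  simp only [dt_add, dt_smul]
  rw [dt_comm τ (gl b c), dt_comm τ (gr (dd o F) P), h1, h2]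
  simp [dt]

def VV (e : ℕ) (F : S3) (b c : ℂ) (o : V3) : Submodule ℂ S3 where
  carrier := {k | k.IsHomogeneous (e + 1) ∧ ∀ P ∈ Gam F b c o, Sg F P → eval P k = 0}
  add_mem' := fun ha hb => ⟨ha.1.add hb.1, fun P hP hs => by rw [map_add, ha.2 P hP hs, hb.2 P hP hs, add_zero]⟩
  zero_mem' := ⟨isHomogeneous_zero _ _ _, fun P _ _ => map_zero _⟩
  smul_mem' := fun t a ha => ⟨(homogeneousSubmodule (Fin 3) ℂ (e + 1)).smul_mem t ha.1,
    fun P hP hs => by rw [smul_eval, ha.2 P hP hs, mul_zero]⟩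

lemma exists_sig (h : Su e F b c o) {D R Q : Finset V3} (hD : ∀ P, P ∈ D ↔ P ∈ Gam F b c o ∧ Sg F P)
    (hR : ∀ P ∈ R, P ∈ Gam F b c o ∧ ¬ Sg F P)
    (hQ : ∀ P ∈ Q, P ∈ Gam F b c o ∧ ¬ Sg F P) (hRQ : ∀ P ∈ R, P ∉ Q)
    (hV : ∀ k ∈ VV e F b c o, (∀ P ∈ R, eval P k = 0) → k = 0) {p : V3} (hp : p ∈ R) :
    ∃ s : S3, s.IsHomogeneous (e + 4) ∧ (∀ P ∈ D, eval P s = 0) ∧ (∀ P ∈ Q, eval P s = 0) ∧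
      eval p s ≠ 0 := by
  classical
  by_contra hcon
  push Not at hcon
  let W := homogeneousSubmodule (Fin 3) ℂ (e + 4)
  let T : Finset V3 := D ∪ Q
  let ev : V3 → S3 →ₗ[ℂ] ℂ := fun P => (aeval (R := ℂ) P).toLinearMap
  have hev : ∀ P u, ev P u = eval P u := fun P u => by simp [ev, aeval_eq_eval]
  have hspan : (ev p).domRestrict W ∈ Submodule.span ℂ (Set.range fun q : T => (ev q).domRestrict W) := by
    apply mem_span_of_iInf_ker_le_ker
    intro u hu
    rw [Submodule.mem_iInf] at hu
    have hu' : ∀ q ∈ T, eval q (u : S3) = 0 := fun q hq => by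
      have := hu ⟨q, hq⟩
      rw [← hev]; exact this
    have := hcon u u.2 (fun P hP => hu' P (Finset.mem_union_left _ hP))
      (fun P hP => hu' P (Finset.mem_union_right _ hP))
    rw [LinearMap.mem_ker]
    rw [← hev] at this; exact this
  obtain ⟨cf, hcf⟩ := (Submodule.mem_span_range_iff_exists_fun ℂ).1 hspan
  let φ : S3 →ₗ[ℂ] ℂ := ev p - ∑ q : T, cf q • ev q
  have hφ : ∀ u, φ u = eval p u - ∑ q : T, cf q * eval (q : V3) u := fun u => by
    simp [φ, LinearMap.sum_apply, hev]
  have hTG : ∀ q ∈ T, q ∈ Gam F b c o := fun q hq => by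
    rcases Finset.mem_union.1 hq with hq | hq
    · exact ((hD q).1 hq).1
    · exact (hQ q hq).1
  have hpG := (hR p hp).1
  have hpT : p ∉ T := by
    intro hh
    rcases Finset.mem_union.1 hh with hq | hq
    · exact (hR p hp).2 ((hD p).1 hq).2
    · exact hRQ p hp hq
  have hφI : ∀ u ∈ II F b c o, φ u = 0 := fun u hu => by
    rw [hφ, mem_mP.1 (II_le_mP hpG hu), Finset.sum_eq_zero, sub_zero]
    intro q _
    rw [mem_mP.1 (II_le_mP (hTG q q.2) hu), mul_zero]
  have hφ4 : ∀ u : S3, u.IsHomogeneous (e + 4) → φ u = 0 := fun u hu => by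
    have := LinearMap.congr_fun hcf ⟨u, hu⟩
    simp only [LinearMap.sum_apply, LinearMap.smul_apply, LinearMap.domRestrict_apply, hev, smul_eq_mul] at this
    rw [hφ, ← this, sub_self]
  obtain ⟨y, hy, hy1, hy2⟩ := h.dual hφI hφ4
  have hyu : ∀ u : S3, eval p u = 0 → (∀ q ∈ T, eval q u = 0) → y * u ∈ II F b c o := by
    intro u hu1 hu2
    refine hy1 u fun v => ?_
    rw [hφ, map_mul, hu1, zero_mul, Finset.sum_eq_zero, sub_zero]
    intro q _
    rw [map_mul, hu2 q q.2, zero_mul, mul_zero]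
  have hy0 : y ≠ 0 := by
    intro h0
    obtain ⟨u, hu1, hu2⟩ := sep T p hpT
    have := hy2 h0 u
    rw [hφ, hu1, Finset.sum_eq_zero, sub_zero] at this
    · exact one_ne_zero this
    · intro q _
      rw [hu2 q q.2, mul_zero]
  have hyR : ∀ q ∈ R, q ≠ p → eval q y = 0 := by
    intro q hq hqp
    have hqn : q ∉ insert p T := by
      intro hh
      rcases Finset.mem_insert.1 hh with hh | hh
      · exact hqp hh
      rcases Finset.mem_union.1 hh with hh | hh
      · exact (hR q hq).2 ((hD q).1 hh).2
      · exact hRQ q hq hh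
    obtain ⟨u, hu1, hu2⟩ := sep _ q hqn
    have := mem_mP.1 (II_le_mP (hR q hq).1 (hyu u (hu2 p (Finset.mem_insert_self _ _))
      fun r hr => hu2 r (Finset.mem_insert_of_mem hr)))
    rwa [map_mul, hu1, mul_one] at this
  have hyD : ∀ q ∈ Gam F b c o, Sg F q → eval q y = 0 := by
    intro q hq hs
    obtain ⟨τ, hτ, h1, h2⟩ := ker2 (gl b c) (gr (dd o F) q)
    obtain ⟨i, hi⟩ := Function.ne_iff.1 hτ
    obtain ⟨u, hu1, hu2⟩ := sep ((insert p T).erase q) q (Finset.notMem_erase _ _)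
    have hz : ∀ r ∈ insert p T, eval r (u * xx q i) = 0 := by
      intro r hr
      by_cases hrq : r = q
      · rw [hrq, map_mul, mem_mP.1 (xx_mem q i), mul_zero]
      · rw [map_mul, hu2 r (Finset.mem_erase.2 ⟨hrq, hr⟩), zero_mul]
    have h3 := h.node_deriv hq hs h1 h2 (hyu (u * xx q i) (hz p (Finset.mem_insert_self _ _))
      fun r hr => hz r (Finset.mem_insert_of_mem hr))
    have h4 : gr (xx q i) q = Pi.single i 1 := by
      funext j
      simp [gr, xx, pderiv_X, Pi.single_apply, eq_comm]
    rw [gr_mul, gr_mul, h4, hu1, map_mul, mem_mP.1 (xx_mem q i)] at h3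
    have h5 : dt τ (Pi.single i 1) = τ i := by
      fin_cases i <;> simp [dt]
    simp only [mul_zero, zero_smul, one_smul, add_zero, dt_smul, h5] at h3
    exact (mul_eq_zero.1 h3).resolve_right hi
  obtain ⟨v, hv, hv1, -⟩ := ker2 p p
  have hly : linF v * y ∈ VV e F b c o := by
    refine ⟨hom_cast ((linF_hom v).mul hy) (by ring), fun P hP hs => ?_⟩
    rw [map_mul, hyD P hP hs, mul_zero]
  have := hV _ hly fun P hP => by
    by_cases hPp : P = p
    · rw [hPp, map_mul, eval_linF', dt_comm, hv1, zero_mul]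
    · rw [map_mul, hyR P hP hPp, mul_zero]
  rcases mul_eq_zero.1 this with h0 | h0
  · exact linF_ne hv h0
  · exact hy0 h0
end Su


def det3 (a o x : V3) : ℂ :=
  a 0 * (o 1 * x 2 - o 2 * x 1) + a 1 * (o 2 * x 0 - o 0 * x 2) + a 2 * (o 0 * x 1 - o 1 * x 0)

lemma det3_zero {a o x : V3} {α β γ : ℂ} (hne : ¬ (α = 0 ∧ β = 0 ∧ γ = 0))
    (h0 : α • o + β • x + γ • a = 0) : det3 a o x = 0 := by
  have e0 := congrFun h0 0
  have e1 := congrFun h0 1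
  have e2 := congrFun h0 2
  simp only [Pi.add_apply, Pi.smul_apply, smul_eq_mul, Pi.zero_apply] at e0 e1 e2
  by_contra hd
  apply hne
  refine ⟨?_, ?_, ?_⟩
  · refine (mul_eq_zero.1 (?_ : α * det3 a o x = 0)).resolve_right hd
    unfold det3
    linear_combination (a 2 * x 1 - a 1 * x 2) * e0 + (a 0 * x 2 - a 2 * x 0) * e1 + (a 1 * x 0 - a 0 * x 1) * e2
  · refine (mul_eq_zero.1 (?_ : β * det3 a o x = 0)).resolve_right hd
    unfold det3
    linear_combination (a 1 * o 2 - a 2 * o 1) * e0 + (a 2 * o 0 - a 0 * o 2) * e1 + (a 0 * o 1 - a 1 * o 0) * e2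
  · refine (mul_eq_zero.1 (?_ : γ * det3 a o x = 0)).resolve_right hd
    unfold det3
    linear_combination (o 1 * x 2 - o 2 * x 1) * e0 + (o 2 * x 0 - o 0 * x 2) * e1 + (o 0 * x 1 - o 1 * x 0) * e2

lemma rel_of_det3 {a o x : V3} (hd : det3 a o x = 0) :
    ∃ α β γ : ℂ, ¬ (α = 0 ∧ β = 0 ∧ γ = 0) ∧ α • a + β • o + γ • x = 0 := by
  have hdet : (Matrix.of ![a, o, x]).det = 0 := by
    rw [Matrix.det_fin_three]
    simp only [det3] at hd
    simp
    linear_combination hd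
  obtain ⟨v, hv, h0⟩ := Matrix.exists_vecMul_eq_zero_iff.2 hdet
  refine ⟨v 0, v 1, v 2, ?_, ?_⟩
  · rintro ⟨h1, h2, h3⟩
    apply hv
    funext i
    fin_cases i <;> assumption
  · funext i
    have := congrFun h0 i
    simpa [Matrix.vecMul, dotProduct, Fin.sum_univ_three] using this

namespace Su
variable {e : ℕ} {F : S3} {b c : ℂ} {o : V3}

lemma det_iff (h : Su e F b c o) {P a : V3} (hP : P ∈ Gam F b c o) (hs : ¬ Sg F P) :
    dt (gr F P) a = 0 ↔ det3 a o P = 0 := by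
  have ho : dt (gr F P) o = 0 := by rw [dt_gr_o, hP.2.2]
  have hp : dt (gr F P) P = 0 := by rw [dt_gr_P h.hF, hP.2.1, mul_zero]
  constructor
  · intro ha
    obtain ⟨α, β, γ, hne, h0⟩ := lin3 (fun h0 => hs fun i => congrFun h0 i) ho hp ha
    exact det3_zero hne h0
  · intro hd
    obtain ⟨α, β, γ, hne, h0⟩ := rel_of_det3 hd
    have hα : α ≠ 0 := by
      rintro rfl
      rw [zero_smul, zero_add] at h0
      have hβ := h.o_ne hP.2.1 h0
      rw [hβ, zero_smul, zero_add] at h0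
      exact hne ⟨rfl, hβ, (smul_eq_zero.1 h0).resolve_right (Gam_ne hP)⟩
    have := congrArg (dt (gr F P)) h0
    rw [dt_add, dt_add, dt_smul, dt_smul, dt_smul, ho, hp, show dt (gr F P) 0 = 0 by simp [dt]] at this
    have h1 : α * dt (gr F P) a = 0 := by linear_combination this
    exact (mul_eq_zero.1 h1).resolve_left hα

lemma two_forms {p : V3} (hp : p ∈ Gam F b c o) : ∃ v1 v2 q : V3, v1 ≠ 0 ∧ dt v1 p = 0 ∧ dt v2 p = 0 ∧
    dt v1 q = 0 ∧ dt v2 q ≠ 0 := by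
  obtain ⟨v1, hv1, h1, -⟩ := ker2 p p
  obtain ⟨q, hq, h2, h3⟩ := ker2 v1 (gl b c)
  obtain ⟨i, hi⟩ := Function.ne_iff.1 hq
  have hs : ∀ w : V3, dt w (Pi.single i 1) = w i := by
    intro w
    fin_cases i <;> simp [dt]
  refine ⟨v1, Pi.single i 1 + (-(p i)) • gl b c, q, hv1, by rw [dt_comm, h1], ?_, h2, ?_⟩
  · rw [dt_comm, dt_add, dt_smul, hs, dt_comm p, dt_gl' p, hp.1]; ring
  · rw [dt_comm, dt_add, dt_smul, hs, dt_comm q, h3]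
    simpa using hi

/-- the colon trick -/
lemma colon_trick (h : Su e F b c o) {p : V3} (hp : p ∈ Gam F b c o) {u : S3} (hu : u.IsHomogeneous (2 * e + 4))
    (hI : ∀ v, dt v p = 0 → linF v * u ∈ II F b c o) : eval p u = 0 := by
  obtain ⟨v1, v2, q, hv1, h1, h2, h3, h4⟩ := two_forms hp
  have rep : ∀ v, dt v p = 0 → ∃ α β : S3, linF v * u = α * F + β * dd o F ∧ β.IsHomogeneous (e + 2) := by
    intro v hv
    have hh : (linF v * u).IsHomogeneous (2 * e + 5) := hom_cast ((linF_hom v).mul hu) (by ring)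
    obtain ⟨α, β, hab⟩ := mem_KK.1 (h.KK_of_II hh (hI v hv))
    obtain ⟨α, β, hab, -, hβ, -⟩ := hom_rep2 h.hF h.hG hh hab.symm
    exact ⟨α, β, hab, hom_cast hβ (by omega)⟩
  obtain ⟨α, β, hab, hβ⟩ := rep v1 h1
  obtain ⟨α', β', hab', hβ'⟩ := rep v2 h2
  have hF : Prime F := h.hirr.prime
  have hd : F ∣ dd o F * (linF v1 * β' - linF v2 * β) :=
    ⟨linF v2 * α - linF v1 * α', by linear_combination linF v2 * hab - linF v1 * hab'⟩
  have hd2 := (hF.dvd_or_dvd hd).resolve_left h.F_not_dvd_G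
  have hh : (linF v1 * β' - linF v2 * β).IsHomogeneous (e + 3) :=
    (hom_cast ((linF_hom v1).mul hβ') (by ring)).sub (hom_cast ((linF_hom v2).mul hβ) (by ring))
  have hz : linF v1 * β' - linF v2 * β = 0 := hom_dvd_lt h.hF hh hd2 (by omega)
  have hz2 : linF v2 * α - linF v1 * α' = 0 := by
    have : F * (linF v2 * α - linF v1 * α') = 0 := by
      linear_combination linF v1 * hab' - linF v2 * hab + dd o F * hz
    exact (mul_eq_zero.1 this).resolve_left hF.ne_zero
  have hl : Prime (linF v1) := (linF_irr hv1).prime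
  have hnd : ¬ linF v1 ∣ linF v2 := by
    rintro ⟨s, hs⟩
    apply h4
    rw [← eval_linF', hs, map_mul, eval_linF', h3, zero_mul]
  obtain ⟨β1, rfl⟩ := (hl.dvd_or_dvd (⟨β', by linear_combination -hz⟩ : linF v1 ∣ linF v2 * β)).resolve_left hnd
  obtain ⟨α1, rfl⟩ := (hl.dvd_or_dvd (⟨α', by linear_combination hz2⟩ : linF v1 ∣ linF v2 * α)).resolve_left hnd
  have : u = α1 * F + β1 * dd o F := by
    apply mul_left_cancel₀ hl.ne_zero
    rw [hab]; ring
  rw [this]; simp [hp.2.1, hp.2.2]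

lemma Sg_F {P : V3} {n : ℕ} (hF : F.IsHomogeneous (n + 1)) (hs : Sg F P) : eval P F = 0 := by
  have := euler_eval hF P
  rw [Finset.sum_eq_zero (fun i _ => by rw [hs i, mul_zero])] at this
  have h2 : ((n + 1 : ℕ) : ℂ) ≠ 0 := by exact_mod_cast (by omega : n + 1 ≠ 0)
  exact (mul_eq_zero.1 this.symm).resolve_left h2

lemma norm_mem (h : Su e F b c o) {P : V3} (hP : P ≠ 0) (hs : Sg F P) :
    ∃ t : ℂ, t ≠ 0 ∧ t • P ∈ Gam F b c o ∧ Sg F (t • P) := by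
  have hl := h.lD P hP hs
  rw [← eval_ell] at hl
  refine ⟨(eval P (ell b c))⁻¹, inv_ne_zero hl, ⟨?_, ?_, ?_⟩, hs.smul h.hF⟩
  · rw [hom_eval_smul (ell_hom b c), pow_one, inv_mul_cancel₀ hl]
  · exact Sg_F h.hF (hs.smul h.hF)
  · rw [← dt_gr_o, gr_Sg (hs.smul h.hF)]; simp [dt]

theorem main (h : Su e F b c o) : ∃ s : S3, s.IsHomogeneous (e + 4) ∧ (∀ P, P ≠ 0 → Sg F P → eval P s = 0) ∧
    ∀ (a : Fin 3 → S3) (k : S3), (∀ i, (a i).IsHomogeneous (e + 2)) → k.IsHomogeneous (e + 1) →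
      (∀ P, P ≠ 0 → Sg F P → eval P k = 0) →
      a 0 * pderiv 0 F + a 1 * pderiv 1 F + a 2 * pderiv 2 F = s * k → k = 0 := by
  classical
  let G := h.Gam_fin.toFinset
  have hG : ∀ P, P ∈ G ↔ P ∈ Gam F b c o := fun P => h.Gam_fin.mem_toFinset
  let D := G.filter fun P => Sg F P
  let R := G.filter fun P => ¬ Sg F P
  have hD : ∀ P, P ∈ D ↔ P ∈ Gam F b c o ∧ Sg F P := fun P => by
    rw [Finset.mem_filter, hG]
  have hR : ∀ P, P ∈ R ↔ P ∈ Gam F b c o ∧ ¬ Sg F P := fun P => by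
    rw [Finset.mem_filter, hG]
  obtain ⟨R', hR'R, hsep, hdual⟩ := choose_sep (VV e F b c o) R fun k hk hk0 => by
    refine h.inj hk.1 fun P hP => ?_
    by_cases hs : Sg F P
    · exact hk.2 P hP hs
    · exact hk0 P ((hR P).2 ⟨hP, hs⟩)
  let Q := R \ R'
  let W : Submodule ℂ S3 :=
    { carrier := {s | s.IsHomogeneous (e + 4) ∧ ∀ P ∈ D ∪ Q, eval P s = 0}
      add_mem' := fun ha hb => ⟨ha.1.add hb.1, fun P hP => by rw [map_add, ha.2 P hP, hb.2 P hP, add_zero]⟩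
      zero_mem' := ⟨isHomogeneous_zero _ _ _, fun P _ => map_zero _⟩
      smul_mem' := fun t a ha => ⟨(homogeneousSubmodule (Fin 3) ℂ (e + 4)).smul_mem t ha.1,
        fun P hP => by rw [smul_eval, ha.2 P hP, mul_zero]⟩ }
  obtain ⟨s, ⟨hs, hs0⟩, hsR⟩ := combine W R' fun p hp => by
    obtain ⟨s, h1, h2, h3, h4⟩ := h.exists_sig (D := D) (R := R') (Q := Q) hD
      (fun P hP => (hR P).1 (hR'R hP)) (fun P hP => (hR P).1 (Finset.sdiff_subset hP))
      (fun P hP hPQ => (Finset.mem_sdiff.1 hPQ).2 hP) hsep hp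
    exact ⟨s, ⟨h1, fun P hP => (Finset.mem_union.1 hP).elim (h2 P) (h3 P)⟩, h4⟩
  refine ⟨s, hs, ?_, ?_⟩
  · intro P hP hPs
    obtain ⟨t, ht, h1, h2⟩ := h.norm_mem hP hPs
    have := hs0 (t • P) (Finset.mem_union_left _ ((hD _).2 ⟨h1, h2⟩))
    rw [hom_eval_smul hs] at this
    exact (mul_eq_zero.1 this).resolve_left (pow_ne_zero _ ht)
  intro a k ha hk hk0 heq
  have hkV : k ∈ VV e F b c o := ⟨hk, fun P hP hPs => hk0 P (Gam_ne hP) hPs⟩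
  refine hsep k hkV ?_
  let t : S3 := a 0 * (C (o 1) * X 2 - C (o 2) * X 1) + a 1 * (C (o 2) * X 0 - C (o 0) * X 2) +
    a 2 * (C (o 0) * X 1 - C (o 1) * X 0)
  have hlin : ∀ i j : Fin 3, (C (o i) * X j - C (o j) * X i : S3).IsHomogeneous 1 := fun i j =>
    (isHomogeneous_C_mul_X _ _).sub (isHomogeneous_C_mul_X _ _)
  have ht : t.IsHomogeneous (e + 3) :=
    (((ha 0).mul (hlin 1 2)).add ((ha 1).mul (hlin 2 0))).add ((ha 2).mul (hlin 0 1))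
  let av : V3 → V3 := fun P i => eval P (a i)
  have hte : ∀ P, eval P t = det3 (av P) o P := fun P => by simp [t, det3, av]
  have hsk : ∀ P, dt (gr F P) (av P) = eval P s * eval P k := fun P => by
    rw [← map_mul, ← heq]; simp [dt, gr, av]; ring
  have htD : ∀ P ∈ Gam F b c o, Sg F P → eval P t = 0 := by
    intro P hP hPs
    have hv0 : hv F P (av P) = 0 := by
      have h1 := congrArg (fun f => gr f P) heq
      have hsP : eval P s = 0 := hs0 P (Finset.mem_union_left _ ((hD _).2 ⟨hP, hPs⟩))
      have hp := fun i => hPs i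
      simp only [gr_mul, gr_add, hsP, hk0 P (Gam_ne hP) hPs, hp 0, hp 1, hp 2, zero_smul, add_zero] at h1
      funext i
      have h2 := congrFun h1 i
      simp only [Pi.add_apply, Pi.smul_apply, smul_eq_mul, gr, Pi.zero_apply] at h2
      simp only [hv, hs_symm F P i, Fin.sum_univ_three, av, Pi.zero_apply]
      exact h2
    obtain ⟨r, hr⟩ := h.hv_ne (Gam_ne hP) hPs hv0
    rw [hte, hr]
    simp only [det3, Pi.smul_apply, smul_eq_mul]; ring
  intro p hp
  obtain ⟨g, hgV, hgp, hgq⟩ := hdual p hp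
  have hpR := (hR p).1 (hR'R hp)
  have hu : eval p (t * g) = 0 := by
    refine h.colon_trick hpR.1 (hom_cast (ht.mul hgV.1) (by ring)) fun v hv => ?_
    have : linF v * (t * g) = t * (linF v * g) := by ring
    rw [this]
    refine h.F3 (fun P hP hPs => ⟨htD P hP hPs, by rw [map_mul, hgV.2 P hP hPs, mul_zero]⟩) ?_
    intro P hP
    by_cases hPs : Sg F P
    · rw [map_mul, htD P hP hPs, zero_mul]
    · by_cases hPR : P ∈ R'
      · by_cases hPp : P = p
        · rw [hPp, map_mul, map_mul, eval_linF', hv]; ring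
        · rw [map_mul, map_mul, hgq P hPR hPp]; ring
      · have hPQ : P ∈ Q := Finset.mem_sdiff.2 ⟨(hR P).2 ⟨hP, hPs⟩, hPR⟩
        have h1 := hsk P
        rw [hs0 P (Finset.mem_union_right _ hPQ), zero_mul, h.det_iff hP hPs, ← hte] at h1
        rw [map_mul, h1, zero_mul]
  rw [map_mul] at hu
  have ht0 := (mul_eq_zero.1 hu).resolve_right hgp
  rw [hte, ← h.det_iff hpR.1 hpR.2, hsk] at ht0
  exact (mul_eq_zero.1 ht0).resolve_left (hsR p hp)
end Su

lemma rep_scale (v : V3) (hv : v ≠ 0) :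
    ∃ t : ℂ, t ≠ 0 ∧ (Projectivization.mk ℂ v hv).rep = t • v := by
  obtain ⟨t, ht⟩ := Projectivization.exists_smul_eq_mk_rep ℂ v hv
  exact ⟨t, t.ne_zero, ht.symm⟩

lemma Sg_of_rep {d : ℕ} {F : S3} (hF : F.IsHomogeneous d) {v : V3} (hv : v ≠ 0) :
    Sg F v ↔ SingPt F (Projectivization.mk ℂ v hv) := by
  obtain ⟨t, ht, hrep⟩ := rep_scale v hv
  constructor
  · intro hs i
    rw [hrep]; exact hs.smul hF i
  · intro hs i
    have := hs i
    rw [hrep, hom_eval_smul hF.pderiv] at this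
    exact (mul_eq_zero.1 this).resolve_left (pow_ne_zero _ ht)

lemma ker_of_rank {M : Matrix (Fin 3) (Fin 3) ℂ} (hM : M.rank = 2) {p v : V3} (hp : p ≠ 0)
    (h1 : M.mulVec p = 0) (h2 : M.mulVec v = 0) : ∃ t : ℂ, v = t • p := by
  have hr := M.mulVecLin.finrank_range_add_finrank_ker
  have hM' : Module.finrank ℂ (LinearMap.range M.mulVecLin) = 2 := hM
  rw [hM', Module.finrank_fin_fun] at hr
  have hk : Module.finrank ℂ (LinearMap.ker M.mulVecLin) = 1 := by omega
  have hpk : p ∈ LinearMap.ker M.mulVecLin := by rw [LinearMap.mem_ker, Matrix.mulVecLin_apply, h1]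
  have hvk : v ∈ LinearMap.ker M.mulVecLin := by rw [LinearMap.mem_ker, Matrix.mulVecLin_apply, h2]
  obtain ⟨t, ht⟩ := (finrank_eq_one_iff_of_nonzero' (⟨p, hpk⟩ : LinearMap.ker M.mulVecLin)
    (fun h0 => hp (congrArg Subtype.val h0))).1 hk ⟨v, hvk⟩
  exact ⟨t, (congrArg Subtype.val ht).symm⟩

lemma mk_Ctx {e : ℕ} {F : S3} (hF : F.IsHomogeneous (e + 4)) (hirr : Irreducible F) (hnodal : Nodal F)
    (hfin : (nodes F).Finite) : Ctx e F where
  hF := hF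
  hirr := hirr
  nod := by
    intro p hp hs v hv
    have hs' : Sg F p := hs
    obtain ⟨t, ht, hrep⟩ := rep_scale p hp
    obtain ⟨-, hr⟩ := hnodal _ ((Sg_of_rep hF hp).1 hs')
    refine ker_of_rank hr hp ?_ ?_
    · funext i
      have h1 := euler_eval (hF.pderiv (i := i)) p
      rw [hs i, mul_zero] at h1
      simp only [Matrix.mulVec, dotProduct, Matrix.of_apply, hrep, Pi.zero_apply]
      rw [← mul_zero (t ^ (e + 4 - 1 - 1)), ← h1, Finset.mul_sum]
      refine Finset.sum_congr rfl fun j _ => ?_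
      rw [hom_eval_smul hF.pderiv.pderiv, pd_comm i j]; ring
    · funext i
      simp only [Matrix.mulVec, dotProduct, Matrix.of_apply, hrep, Pi.zero_apply]
      rw [← mul_zero (t ^ (e + 4 - 1 - 1)), ← hv i, Finset.mul_sum]
      refine Finset.sum_congr rfl fun j _ => ?_
      rw [hom_eval_smul hF.pderiv.pderiv, pd_comm i j]; ring
  fin := by
    classical
    refine ⟨hfin.toFinset.image fun p => p.rep, ?_, ?_⟩
    · intro b hb
      obtain ⟨p, hp, rfl⟩ := Finset.mem_image.1 hb
      exact ⟨p.rep_nonzero, ((hfin.mem_toFinset).1 hp).1⟩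
    · intro p hp hs
      obtain ⟨t, ht, hrep⟩ := rep_scale p hp
      refine ⟨_, Finset.mem_image.2 ⟨Projectivization.mk ℂ p hp, hfin.mem_toFinset.2
        (hnodal _ ((Sg_of_rep hF hp).1 hs)), rfl⟩, t⁻¹, inv_ne_zero ht, ?_⟩
      rw [hrep, smul_smul, inv_mul_cancel₀ ht, one_smul]

theorem stmt_10_main (d : ℕ) (hd : 4 ≤ d) (F : MvPolynomial (Fin 3) ℂ)
    (hF : F.IsHomogeneous d) (hirr : Irreducible F) (hnodal : Nodal F)
    (hfin : (nodes F).Finite) :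
    ∃ σ : MvPolynomial (Fin 3) ℂ, σ.IsHomogeneous d ∧
      (∀ p ∈ nodes F, VanAt σ p) ∧
      ∀ a b c h : MvPolynomial (Fin 3) ℂ,
        a.IsHomogeneous (d - 2) → b.IsHomogeneous (d - 2) → c.IsHomogeneous (d - 2) →
        h.IsHomogeneous (d - 3) → (∀ p ∈ nodes F, VanAt h p) →
        a * pderiv 0 F + b * pderiv 1 F + c * pderiv 2 F = σ * h → h = 0 := by
  obtain ⟨e, rfl⟩ : ∃ e, d = e + 4 := ⟨d - 4, by omega⟩
  obtain ⟨b, c, o, hSu⟩ := (mk_Ctx hF hirr hnodal hfin).exists_Su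
  obtain ⟨s, hs, hs0, hmain⟩ := hSu.main
  refine ⟨s, hs, fun p hp => hs0 p.rep p.rep_nonzero hp.1, ?_⟩
  intro a1 a2 a3 k h1 h2 h3 hk hk0 heq
  have hk' : k.IsHomogeneous (e + 1) := hom_cast hk (by omega)
  refine hmain ![a1, a2, a3] k ?_ hk' ?_ (by simpa using heq)
  · intro i
    fin_cases i
    · exact hom_cast h1 (by omega)
    · exact hom_cast h2 (by omega)
    · exact hom_cast h3 (by omega)
  · intro P hP hPs
    obtain ⟨t, ht, hrep⟩ := rep_scale P hP
    have := hk0 _ (hnodal _ ((Sg_of_rep hF hP).1 hPs))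
    rw [VanAt, hrep, hom_eval_smul hk'] at this
    exact (mul_eq_zero.1 this).resolve_left (pow_ne_zero _ ht)


theorem stmt_10 (d : ℕ) (hd : 4 ≤ d) (F : MvPolynomial (Fin 3) ℂ)
    (hF : F.IsHomogeneous d) (hirr : Irreducible F) (hnodal : Nodal F)
    (hfin : (nodes F).Finite)
    (hn : (nodes F).ncard ≤ (d - 1).choose 2 - 1) :
    ∃ σ : MvPolynomial (Fin 3) ℂ, σ.IsHomogeneous d ∧
      (∀ p ∈ nodes F, VanAt σ p) ∧
      ∀ a b c h : MvPolynomial (Fin 3) ℂ,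
        a.IsHomogeneous (d - 2) → b.IsHomogeneous (d - 2) → c.IsHomogeneous (d - 2) →
        h.IsHomogeneous (d - 3) → (∀ p ∈ nodes F, VanAt h p) →
        a * pderiv 0 F + b * pderiv 1 F + c * pderiv 2 F = σ * h → h = 0 := by
  exact stmt_10_main d hd F hF hirr hnodal hfin

end
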